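/- arXiv:math/0301336 — 5 statements merged into one kernel-verified Lean document; each statement's English description precedes it below -/
import Mathlib

section
/- Let k, ℓ ≥ 1 and let J be a maximal proper two-sided ideal of T_{k,ℓ}. Then J is one of the following: (a) J = ker ψ₀₀^{i₀ i₀'} for some 0 ≤ i₀ ≤ k−1, 0 ≤ i₀' ≤ ℓ−1, where ψ₀₀^{i₀ i₀'}(F) = f_{(i₀,i₀'),(i₀,i₀')}(0,0); (b) J = ker ψ_{0μ}^{i₀} for some 0 ≤ i₀ ≤ k−1 and μ in the closed unit disk with μ ≠ 0, where ψ_{0μ}^{i₀}(F) = (f_{(i₀,i'),(i₀,j')}(0,μ))_{i',j'}; (c) J = ker ψ_{λ0}^{i₀'} for some 0 ≤ i₀' ≤ ℓ−1 and λ in the closed unit disk with λ ≠ 0, where ψ_{λ0}^{i₀'}(F) = (f_{(i,i₀'),(j,i₀')}(λ,0))_{i,j}; or (d) J = ker ψ_{λμ} for some λ, μ in the closed unit disk both nonzero, where ψ_{λμ}(F) = F(λ,μ). -/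
noncomputable section

/-- The closed bidisk `{(z,w) : ‖z‖ ≤ 1, ‖w‖ ≤ 1}` in `ℂ²`. -/
def Bidisk : Set (ℂ × ℂ) := Metric.closedBall 0 1 ×ˢ Metric.closedBall 0 1

instance : CompactSpace Bidisk :=
  isCompact_iff_compactSpace.mp ((isCompact_closedBall _ _).prod (isCompact_closedBall _ _))

/-- The point `(0,0)` of the closed bidisk. -/
def pt0 : Bidisk := ⟨(0, 0), by simp [Bidisk]⟩

/-- `g` has the two-variable power series expansion with coefficients `a`,
converging at every point of the open bidisk. -/
def HasCoeffsAt (g : Bidisk → ℂ) (a : ℕ → ℕ → ℂ) : Prop :=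
  ∀ p : Bidisk, ‖(p : ℂ × ℂ).1‖ < 1 → ‖(p : ℂ × ℂ).2‖ < 1 →
    HasSum (fun mn : ℕ × ℕ => a mn.1 mn.2 * (p : ℂ × ℂ).1 ^ mn.1 * (p : ℂ × ℂ).2 ^ mn.2) (g p)

/-- The ambient algebra of continuous `M_{kℓ}(ℂ)`-valued functions on the closed bidisk,
with entries indexed by pairs `(i,i')`, `(j,j')`, `0 ≤ i,j ≤ k-1`, `0 ≤ i',j' ≤ ℓ-1`. -/
abbrev TM (k l : ℕ) := C(Bidisk, Matrix (Fin k × Fin l) (Fin k × Fin l) ℂ)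

/-- Membership in `T_{k,ℓ}` (the concrete realization of `B_k ⊗̂ B_ℓ`): the power series
coefficients `a m n` of the entry `f_{(i,i'),(j,j')}` vanish unless `m ≡ i - j (mod k)`
and `n ≡ i' - j' (mod ℓ)`. -/
def memT (k l : ℕ) (F : TM k l) : Prop :=
  ∀ (i j : Fin k) (i' j' : Fin l), ∃ a : ℕ → ℕ → ℂ,
    HasCoeffsAt (fun p => F p (i, i') (j, j')) a ∧
    ∀ m n : ℕ, ¬ (Int.ModEq (k : ℤ) (m : ℤ) ((i : ℤ) - (j : ℤ)) ∧
      Int.ModEq (l : ℤ) (n : ℤ) ((i' : ℤ) - (j' : ℤ))) → a m n = 0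

/-- `J` is a two-sided ideal of the subring of `R` with carrier set `S`. -/
def IsIdealIn {R : Type*} [Ring R] (S J : Set R) : Prop :=
  J ⊆ S ∧ (0 : R) ∈ J ∧ (∀ f ∈ J, ∀ g ∈ J, f + g ∈ J) ∧ (∀ f ∈ J, -f ∈ J) ∧
    ∀ f ∈ S, ∀ g ∈ J, f * g ∈ J ∧ g * f ∈ J

/-- `J` is a maximal proper two-sided ideal of the subring of `R` with carrier set `S`. -/
def IsMaxIdealIn {R : Type*} [Ring R] (S J : Set R) : Prop :=
  IsIdealIn S J ∧ J ≠ S ∧ ∀ J' : Set R, IsIdealIn S J' → J ⊆ J' → J' = J ∨ J' = S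

/-- The functional `ψ₀₀^{i₀i₀'} : F ↦ f_{(i₀,i₀'),(i₀,i₀')}(0,0)`. -/
def psiA (k l : ℕ) (i₀ : Fin k) (i₀' : Fin l) (F : TM k l) : ℂ := F pt0 (i₀, i₀') (i₀, i₀')

/-- The map `ψ_{0μ}^{i₀} : F ↦ (f_{(i₀,i'),(i₀,j')}(0,μ))_{i',j'}` into `M_ℓ(ℂ)`. -/
def psiB (k l : ℕ) (i₀ : Fin k) (p : Bidisk) (F : TM k l) : Matrix (Fin l) (Fin l) ℂ :=
  Matrix.of fun i' j' => F p (i₀, i') (i₀, j')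

/-- The map `ψ_{λ0}^{i₀'} : F ↦ (f_{(i,i₀'),(j,i₀')}(λ,0))_{i,j}` into `M_k(ℂ)`. -/
def psiC (k l : ℕ) (i₀' : Fin l) (p : Bidisk) (F : TM k l) : Matrix (Fin k) (Fin k) ℂ :=
  Matrix.of fun i j => F p (i, i₀') (j, i₀')

/-- The evaluation map `ψ_{λμ} : F ↦ F(λ,μ)` into `M_{kℓ}(ℂ)`. -/
def psiD (k l : ℕ) (p : Bidisk) (F : TM k l) : Matrix (Fin k × Fin l) (Fin k × Fin l) ℂ := F p

namespace Bidisk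

open MeasureTheory AddCircle

/-- The monomial `z ^ m * w ^ n` on the closed bidisk. -/
def mono (m n : ℕ) : C(Bidisk, ℂ) where
  toFun p := (p : ℂ × ℂ).1 ^ m * (p : ℂ × ℂ).2 ^ n

lemma mono_apply (m n : ℕ) (p : Bidisk) :
    mono m n p = (p : ℂ × ℂ).1 ^ m * (p : ℂ × ℂ).2 ^ n := rfl

lemma mono_mul (m n m' n' : ℕ) : mono m n * mono m' n' = mono (m + m') (n + n') := by
  ext p
  simp only [ContinuousMap.mul_apply, mono_apply]
  ring

lemma mono_zero : mono 0 0 = 1 := by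
  ext p
  simp [mono_apply]

lemma norm_fst_le (p : Bidisk) : ‖(p : ℂ × ℂ).1‖ ≤ 1 := by
  simpa using p.2.1

lemma norm_snd_le (p : Bidisk) : ‖(p : ℂ × ℂ).2‖ ≤ 1 := by
  simpa using p.2.2

lemma norm_mono_le (m n : ℕ) : ‖mono m n‖ ≤ 1 := by
  refine (ContinuousMap.norm_le _ zero_le_one).2 fun p => ?_
  rw [mono_apply, norm_mul, norm_pow, norm_pow]
  exact mul_le_one₀ (pow_le_one₀ (norm_nonneg _) (norm_fst_le p)) (by positivity)
    (pow_le_one₀ (norm_nonneg _) (norm_snd_le p))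

/-- The closed span of the monomials whose pair of exponents lies in `P`. -/
def monoSpan (P : Set (ℕ × ℕ)) : Submodule ℂ C(Bidisk, ℂ) :=
  (Submodule.span ℂ ((fun q : ℕ × ℕ => mono q.1 q.2) '' P)).topologicalClosure

lemma isClosed_monoSpan (P : Set (ℕ × ℕ)) : IsClosed (monoSpan P : Set C(Bidisk, ℂ)) :=
  Submodule.isClosed_topologicalClosure _

lemma mono_mem_monoSpan {P : Set (ℕ × ℕ)} {m n : ℕ} (h : (m, n) ∈ P) : mono m n ∈ monoSpan P :=
  Submodule.le_topologicalClosure _ (Submodule.subset_span ⟨(m, n), h, rfl⟩)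

lemma monoSpan_le {P : Set (ℕ × ℕ)} {M : Submodule ℂ C(Bidisk, ℂ)}
    (hM : IsClosed (M : Set C(Bidisk, ℂ))) (h : ∀ m n, (m, n) ∈ P → mono m n ∈ M) :
    monoSpan P ≤ M :=
  Submodule.topologicalClosure_minimal _
    (Submodule.span_le.2 (by rintro _ ⟨⟨m, n⟩, hq, rfl⟩; exact h m n hq)) hM

lemma mul_mem_monoSpan {P Q R : Set (ℕ × ℕ)}
    (hPQ : ∀ m n m' n', (m, n) ∈ P → (m', n') ∈ Q → (m + m', n + n') ∈ R)
    {f g : C(Bidisk, ℂ)} (hf : f ∈ monoSpan P) (hg : g ∈ monoSpan Q) : f * g ∈ monoSpan R := by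
  have h1 : ∀ m n, (m, n) ∈ P →
      monoSpan Q ≤ (monoSpan R).comap (LinearMap.mulLeft ℂ (mono m n)) := fun m n hp =>
    monoSpan_le ((isClosed_monoSpan R).preimage (continuous_const_mul _)) fun m' n' hq => by
      simpa [mono_mul] using mono_mem_monoSpan (hPQ _ _ _ _ hp hq)
  have h2 : monoSpan P ≤ (monoSpan R).comap (LinearMap.mulRight ℂ g) :=
    monoSpan_le ((isClosed_monoSpan R).preimage (continuous_mul_const _)) fun m n hp => h1 m n hp hg
  exact h2 hf

/-- The point of the distinguished boundary of the bidisk with the given pair of angles. -/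
def torusPoint (x : UnitAddCircle × UnitAddCircle) : Bidisk :=
  ⟨(fourier 1 x.1, fourier 1 x.2), by simp [Bidisk, Circle.norm_coe]⟩

lemma continuous_torusPoint : Continuous torusPoint :=
  Continuous.subtype_mk (by fun_prop) _

lemma fourier_one_pow (x : UnitAddCircle) (n : ℕ) : fourier 1 x ^ n = fourier n x := by
  induction n with
  | zero => simp
  | succ n ih => rw [pow_succ, ih, Nat.cast_succ, fourier_add]

lemma integral_fourier (n : ℤ) :
    ∫ x : UnitAddCircle, fourier n x ∂haarAddCircle = if n = 0 then 1 else 0 := by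
  split_ifs with h
  · subst h; simp
  · exact integral_eq_zero_of_add_right_eq_neg (μ := haarAddCircle)
      (fourier_add_half_inv_index h one_pos)

/-- The `(m, n)`-th power series coefficient, as an integral over the torus. -/
def coeff (m n : ℕ) : C(Bidisk, ℂ) →L[ℂ] ℂ :=
  LinearMap.mkContinuous
    { toFun f := ∫ x : UnitAddCircle × UnitAddCircle,
        fourier (-m) x.1 * fourier (-n) x.2 * f (torusPoint x) ∂haarAddCircle.prod haarAddCircle
      map_add' f g := by
        simp only [ContinuousMap.add_apply, mul_add]
        have hc := continuous_torusPoint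
        refine integral_add ?_ ?_ <;>
        exact Continuous.integrable_of_hasCompactSupport (by fun_prop)
          (HasCompactSupport.of_compactSpace _)
      map_smul' c f := by
        simp only [ContinuousMap.smul_apply, mul_smul_comm, integral_smul, RingHom.id_apply] }
    1 fun f => by
      refine (norm_integral_le_of_norm_le_const (C := ‖f‖) (ae_of_all _ fun x => ?_)).trans ?_
      · rw [norm_mul, norm_mul, fourier_apply, fourier_apply, Circle.norm_coe, Circle.norm_coe,
          one_mul, one_mul]
        exact f.norm_coe_le_norm _
      · simp

lemma norm_coeff_le (m n : ℕ) : ‖coeff m n‖ ≤ 1 := LinearMap.mkContinuous_norm_le _ zero_le_one _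

lemma coeff_mono (m n a b : ℕ) :
    coeff m n (mono a b) = if (m, n) = (a, b) then 1 else 0 := by
  have h : ∀ x : UnitAddCircle × UnitAddCircle,
      fourier (-m) x.1 * fourier (-n) x.2 * mono a b (torusPoint x) =
        fourier (a - m : ℤ) x.1 * fourier (b - n : ℤ) x.2 := fun x => by
    rw [mono_apply, torusPoint, fourier_one_pow, fourier_one_pow, sub_eq_add_neg, sub_eq_add_neg,
      fourier_add, fourier_add]
    ring
  change ∫ x : UnitAddCircle × UnitAddCircle, _ ∂haarAddCircle.prod haarAddCircle = _
  simp_rw [h]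
  rw [integral_prod_mul (fun x : UnitAddCircle => fourier (a - m : ℤ) x)
    (fun x : UnitAddCircle => fourier (b - n : ℤ) x), integral_fourier, integral_fourier]
  simp only [Prod.mk.injEq, sub_eq_zero, Nat.cast_inj, eq_comm (a := a), eq_comm (a := b), ite_and]
  split_ifs <;> simp

lemma summable_pow_mul_pow {z w : ℂ} (hz : ‖z‖ < 1) (hw : ‖w‖ < 1) :
    Summable fun q : ℕ × ℕ => ‖z‖ ^ q.1 * ‖w‖ ^ q.2 :=
  (summable_geometric_of_lt_one (norm_nonneg _) hz).mul_of_nonneg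
    (summable_geometric_of_lt_one (norm_nonneg _) hw) (fun _ => by positivity)
    fun _ => by positivity

lemma hasCoeffsAt_coeff {P : Set (ℕ × ℕ)} {f : C(Bidisk, ℂ)} (hf : f ∈ monoSpan P) :
    HasCoeffsAt f (fun m n => coeff m n f) := by
  intro p hz hw
  set z := (p : ℂ × ℂ).1
  set w := (p : ℂ × ℂ).2
  let u : ℕ × ℕ → C(Bidisk, ℂ) →L[ℂ] ℂ := fun q => (z ^ q.1 * w ^ q.2) • coeff q.1 q.2
  have hu : Summable u := by
    refine Summable.of_norm_bounded (summable_pow_mul_pow hz hw) fun q => ?_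
    rw [norm_smul, norm_mul, norm_pow, norm_pow]
    exact mul_le_of_le_one_right (by positivity) (norm_coeff_le _ _)
  have hsum : ∀ g, HasSum (fun q => u q g) ((∑' q, u q) g) := fun g =>
    hu.hasSum.mapL (ContinuousLinearMap.apply ℂ ℂ g)
  let e : C(Bidisk, ℂ) →L[ℂ] ℂ := ContinuousMap.evalCLM ℂ p
  have hle : monoSpan P ≤ LinearMap.ker ((∑' q, u q) - e).toLinearMap := by
    refine monoSpan_le (ContinuousLinearMap.isClosed_ker _) fun m n _ => ?_
    have h1 : HasSum (fun q => u q (mono m n)) (mono m n p) := by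
      convert hasSum_ite_eq (m, n) (z ^ m * w ^ n) using 2 with q
      obtain ⟨a, b⟩ := q
      simp only [u, smul_apply, coeff_mono, smul_eq_mul]
      split_ifs with h
      · cases h; simp
      · simp
      · rfl
    simpa [sub_eq_zero, e] using (hsum _).unique h1
  have h2 : (∑' q, u q) f = f p := by simpa [sub_eq_zero, e] using hle hf
  rw [← h2]
  convert hsum f using 2 with q
  simp only [u, smul_apply, smul_eq_mul]
  ring

lemma coeff_eq_zero {P : Set (ℕ × ℕ)} {f : C(Bidisk, ℂ)} (hf : f ∈ monoSpan P) {m n : ℕ}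
    (h : (m, n) ∉ P) : coeff m n f = 0 := by
  have hle : monoSpan P ≤ LinearMap.ker (coeff m n).toLinearMap := by
    refine monoSpan_le (ContinuousLinearMap.isClosed_ker _) fun a b hab => ?_
    have : (m, n) ≠ (a, b) := fun he => h (he ▸ hab)
    simp [coeff_mono, this]
  simpa using hle hf

/-- The dilation `(z, w) ↦ (r z, r w)` of the bidisk, for `0 ≤ r ≤ 1`. -/
def dilate (r : unitInterval) (p : Bidisk) : Bidisk :=
  ⟨((r : ℂ) * (p : ℂ × ℂ).1, (r : ℂ) * (p : ℂ × ℂ).2), by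
    have hr : |(r : ℝ)| ≤ 1 := abs_le.2 ⟨by linarith [r.2.1], r.2.2⟩
    simpa [Bidisk] using And.intro
      (mul_le_one₀ hr (norm_nonneg _) (norm_fst_le p))
      (mul_le_one₀ hr (norm_nonneg _) (norm_snd_le p))⟩

lemma continuous_dilate : Continuous fun q : unitInterval × Bidisk => dilate q.1 q.2 :=
  Continuous.subtype_mk (by fun_prop) _

lemma mem_monoSpan_of_hasCoeffsAt {P : Set (ℕ × ℕ)} {f : C(Bidisk, ℂ)} {a : ℕ → ℕ → ℂ}
    (ha : HasCoeffsAt f a) (hP : ∀ m n, (m, n) ∉ P → a m n = 0) : f ∈ monoSpan P := by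
  let F : C(unitInterval × Bidisk, ℂ) :=
    ⟨fun q => f (dilate q.1 q.2), f.continuous.comp continuous_dilate⟩
  have hF1 : F.curry 1 = f := by
    ext p
    simp [F, dilate]
  have hmem : ∀ r : unitInterval, (r : ℝ) < 1 → F.curry r ∈ monoSpan P := by
    intro r hr
    have hr0 : (0 : ℝ) ≤ r := r.2.1
    have hnr : ‖((r : ℝ) : ℂ)‖ < 1 := by simpa [abs_of_nonneg hr0] using hr
    have hs := (ha (dilate r ⟨(1, 1), by simp [Bidisk]⟩) (by simpa [dilate] using hnr)
      (by simpa [dilate] using hnr)).summable.norm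
    let u : ℕ × ℕ → C(Bidisk, ℂ) := fun q =>
      (a q.1 q.2 * (r : ℂ) ^ q.1 * (r : ℂ) ^ q.2) • mono q.1 q.2
    have hu : Summable u := by
      refine Summable.of_norm_bounded hs fun q => ?_
      rw [norm_smul]
      refine (mul_le_of_le_one_right (norm_nonneg _) (norm_mono_le _ _)).trans_eq ?_
      simp [dilate]
    have hsum : F.curry r = ∑' q, u q := by
      ext p
      refine (ha (dilate r p) ?_ ?_).unique ?_
      · simpa [dilate, abs_of_nonneg hr0] using
          mul_lt_one_of_nonneg_of_lt_one_left hr0 hr (norm_fst_le p)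
      · simpa [dilate, abs_of_nonneg hr0] using
          mul_lt_one_of_nonneg_of_lt_one_left hr0 hr (norm_snd_le p)
      · convert hu.hasSum.mapL (ContinuousMap.evalCLM ℂ p) using 2 with q
        · simp [u, dilate, mono_apply, mul_pow]
          ring
        · rfl
    rw [hsum]
    refine (isClosed_monoSpan P).mem_of_tendsto hu.hasSum (.of_forall fun s => ?_)
    refine Submodule.sum_mem _ fun q _ => ?_
    by_cases hq : q ∈ P
    · exact Submodule.smul_mem _ _ (mono_mem_monoSpan hq)
    · simp [u, hP q.1 q.2 hq]
  let r : ℕ → unitInterval := fun n => unitInterval.symm ⟨1 / ((n : ℝ) + 1),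
    by positivity, by rw [div_le_one (by positivity)]; linarith [n.cast_nonneg (α := ℝ)]⟩
  have hr : Filter.Tendsto r Filter.atTop (nhds 1) := by
    rw [tendsto_subtype_rng]
    simpa [r] using tendsto_one_div_add_atTop_nhds_zero_nat.const_sub (1 : ℝ)
  rw [← hF1]
  refine (isClosed_monoSpan P).mem_of_tendsto ((F.curry.continuous.tendsto 1).comp hr)
    (.of_forall fun n => hmem _ ?_)
  have : 0 < 1 / ((n : ℝ) + 1) := by positivity
  simpa [r] using this

end Bidisk

namespace Bidisk

variable {k l : ℕ}

/-- The pairs of exponents congruent to `(d, e)` modulo `(k, l)`. -/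
def degSet (k l : ℕ) (d e : ℤ) : Set (ℕ × ℕ) :=
  {q | (q.1 : ℤ) ≡ d [ZMOD k] ∧ (q.2 : ℤ) ≡ e [ZMOD l]}

lemma mul_mem_monoSpan_degSet {d e d' e' d'' e'' : ℤ} {f g : C(Bidisk, ℂ)}
    (hf : f ∈ monoSpan (degSet k l d e)) (hg : g ∈ monoSpan (degSet k l d' e'))
    (hd : d + d' = d'') (he : e + e' = e'') : f * g ∈ monoSpan (degSet k l d'' e'') := by
  subst hd he
  refine mul_mem_monoSpan (fun m n m' n' h h' => ?_) hf hg
  constructor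
  · push_cast; exact h.1.add h'.1
  · push_cast; exact h.2.add h'.2

lemma one_mem_monoSpan_degSet : (1 : C(Bidisk, ℂ)) ∈ monoSpan (degSet k l 0 0) :=
  mono_zero ▸ mono_mem_monoSpan ⟨rfl, rfl⟩

/-- The algebra of bidisk functions in the variables `z ^ k` and `w ^ l`. -/
def baseAlgebra (k l : ℕ) : Subalgebra ℂ C(Bidisk, ℂ) where
  carrier := monoSpan (degSet k l 0 0)
  mul_mem' hf hg := mul_mem_monoSpan_degSet hf hg (zero_add 0) (zero_add 0)
  add_mem' := Submodule.add_mem _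
  algebraMap_mem' c := by
    rw [Algebra.algebraMap_eq_smul_one]
    exact Submodule.smul_mem _ _ one_mem_monoSpan_degSet

instance : CompleteSpace (baseAlgebra k l) :=
  (isClosed_monoSpan (degSet k l 0 0)).completeSpace_coe

instance : Nonempty Bidisk := ⟨pt0⟩

instance : NormOneClass (baseAlgebra k l) :=
  ⟨(norm_one : ‖(1 : C(Bidisk, ℂ))‖ = 1)⟩

lemma mono_mem_baseAlgebra (m n : ℕ) : mono (k * m) (l * n) ∈ baseAlgebra k l :=
  mono_mem_monoSpan ⟨by simp [Int.modEq_zero_iff_dvd], by simp [Int.modEq_zero_iff_dvd]⟩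

/-- The monomial `z ^ (k * m) * w ^ (l * n)` as an element of the base algebra. -/
def baseMono (k l m n : ℕ) : baseAlgebra k l := ⟨mono (k * m) (l * n), mono_mem_baseAlgebra m n⟩

lemma baseMono_eq (m n : ℕ) : baseMono k l m n = baseMono k l 1 0 ^ m * baseMono k l 0 1 ^ n := by
  refine Subtype.ext (ContinuousMap.ext fun q => ?_)
  simp [baseMono, mono_apply, pow_mul]

lemma exists_pow_eq_apply_baseMono (φ : WeakDual.characterSpace ℂ (baseAlgebra k l)) {N : ℕ}
    (hN : N ≠ 0) (m n : ℕ) : ∃ x : ℂ, ‖x‖ ≤ 1 ∧ x ^ N = φ (baseMono k l m n) := by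
  obtain ⟨x, hx⟩ := IsAlgClosed.exists_pow_nat_eq
    (φ (baseMono k l m n)) (Nat.pos_of_ne_zero hN)
  refine ⟨x, ?_, hx⟩
  rw [← pow_le_one_iff_of_nonneg (norm_nonneg x) hN, ← norm_pow, hx]
  exact (AlgHom.norm_apply_le_self φ _).trans (norm_mono_le _ _)

lemma eval_eq_of_baseMono {φ : baseAlgebra k l →L[ℂ] ℂ} {p : Bidisk}
    (h : ∀ m n, φ (baseMono k l m n) = mono (k * m) (l * n) p) (f : baseAlgebra k l) :
    φ f = (f : C(Bidisk, ℂ)) p := by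
  let e : baseAlgebra k l →L[ℂ] ℂ :=
    (ContinuousMap.evalCLM ℂ p).comp (baseAlgebra k l).toSubmodule.subtypeL
  have hker : monoSpan (degSet k l 0 0) ≤
      (LinearMap.ker (φ - e).toLinearMap).map (baseAlgebra k l).toSubmodule.subtype := by
    refine monoSpan_le ?_ ?_
    · exact (isClosed_monoSpan (degSet k l 0 0)).isClosedMap_subtype_val _
        (ContinuousLinearMap.isClosed_ker (φ - e))
    · rintro m n ⟨hm, hn⟩
      obtain ⟨m, rfl⟩ := Int.natCast_dvd_natCast.1 (Int.modEq_zero_iff_dvd.1 hm)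
      obtain ⟨n, rfl⟩ := Int.natCast_dvd_natCast.1 (Int.modEq_zero_iff_dvd.1 hn)
      exact ⟨baseMono k l m n, sub_eq_zero.2 (h m n), rfl⟩
  obtain ⟨g, hg, hgf⟩ := hker f.2
  obtain rfl : g = f := Subtype.ext hgf
  exact sub_eq_zero.1 hg

lemma exists_eval_eq (hk : k ≠ 0) (hl : l ≠ 0) (φ : WeakDual.characterSpace ℂ (baseAlgebra k l)) :
    ∃ p : Bidisk, ∀ f : baseAlgebra k l, φ f = (f : C(Bidisk, ℂ)) p := by
  obtain ⟨x, hx1, hx⟩ := exists_pow_eq_apply_baseMono φ hk 1 0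
  obtain ⟨y, hy1, hy⟩ := exists_pow_eq_apply_baseMono φ hl 0 1
  refine ⟨⟨(x, y), by simpa [Bidisk] using And.intro hx1 hy1⟩,
    eval_eq_of_baseMono (φ := WeakDual.CharacterSpace.toCLM φ) fun m n => ?_⟩
  change φ _ = _
  rw [baseMono_eq, map_mul, map_pow, map_pow, ← hx, ← hy, mono_apply, pow_mul, pow_mul]

lemma exists_common_zero (hk : k ≠ 0) (hl : l ≠ 0) {I : Ideal (baseAlgebra k l)} (hI : I ≠ ⊤) :
    ∃ p : Bidisk, ∀ f ∈ I, (f : C(Bidisk, ℂ)) p = 0 := by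
  obtain ⟨M, hM, hIM⟩ := I.exists_le_maximal hI
  obtain ⟨p, hp⟩ := exists_eval_eq hk hl M.toCharacterSpace
  exact ⟨p, fun f hf => hp f ▸ M.toCharacterSpace_apply_eq_zero_of_mem (hIM hf)⟩

/-- An entry of a continuous matrix-valued function on the bidisk. -/
def entry (F : TM k l) (α β : Fin k × Fin l) : C(Bidisk, ℂ) where
  toFun p := F p α β
  continuous_toFun := F.continuous.matrix_elem α β

lemma memT_iff {F : TM k l} : memT k l F ↔ ∀ α β : Fin k × Fin l,
    entry F α β ∈ monoSpan (degSet k l ((α.1 : ℤ) - β.1) ((α.2 : ℤ) - β.2)) := by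
  refine ⟨fun h α β => ?_, fun h i j i' j' =>
    ⟨fun m n => coeff m n (entry F (i, i') (j, j')), hasCoeffsAt_coeff (h (i, i') (j, j')),
      fun m n hmn => coeff_eq_zero (h (i, i') (j, j')) hmn⟩⟩
  obtain ⟨a, ha, h0⟩ := h α.1 β.1 α.2 β.2
  exact mem_monoSpan_of_hasCoeffsAt (f := entry F α β) ha h0

lemma memT_zero : memT k l 0 :=
  memT_iff.2 fun _ _ => Submodule.zero_mem _

lemma memT_add {F G : TM k l} (hF : memT k l F) (hG : memT k l G) : memT k l (F + G) :=
  memT_iff.2 fun α β => Submodule.add_mem _ (memT_iff.1 hF α β) (memT_iff.1 hG α β)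

lemma memT_neg {F : TM k l} (hF : memT k l F) : memT k l (-F) :=
  memT_iff.2 fun α β => Submodule.neg_mem _ (memT_iff.1 hF α β)

lemma memT_mul {F G : TM k l} (hF : memT k l F) (hG : memT k l G) : memT k l (F * G) := by
  refine memT_iff.2 fun α β => ?_
  have h : entry (F * G) α β = ∑ γ, entry F α γ * entry G γ β := by
    ext p
    simp [entry, Matrix.mul_apply]
  rw [h]
  exact Submodule.sum_mem _ fun γ _ => mul_mem_monoSpan_degSet (memT_iff.1 hF α γ)
    (memT_iff.1 hG γ β) (by ring) (by ring)

/-- The matrix-valued function whose only nonzero entry is `f`, at `(α, β)`. -/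
def single (α β : Fin k × Fin l) (f : C(Bidisk, ℂ)) : TM k l where
  toFun p := Matrix.single α β (f p)
  continuous_toFun := by
    refine continuous_matrix fun γ δ => ?_
    simp only [Matrix.single_apply]
    split_ifs <;> fun_prop

lemma single_apply (α β : Fin k × Fin l) (f : C(Bidisk, ℂ)) (p : Bidisk) :
    single α β f p = Matrix.single α β (f p) := rfl

lemma entry_single_same (α β : Fin k × Fin l) (f : C(Bidisk, ℂ)) :
    entry (single α β f) α β = f := by
  ext p
  simp [entry, single_apply]

lemma memT_single {α β : Fin k × Fin l} {f : C(Bidisk, ℂ)}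
    (hf : f ∈ monoSpan (degSet k l ((α.1 : ℤ) - β.1) ((α.2 : ℤ) - β.2))) :
    memT k l (single α β f) := by
  refine memT_iff.2 fun γ δ => ?_
  by_cases h : α = γ ∧ β = δ
  · obtain ⟨rfl, rfl⟩ := h
    rwa [entry_single_same]
  · have : entry (single α β f) γ δ = 0 := by
      ext p
      simp [entry, single_apply, h]
    rw [this]
    exact Submodule.zero_mem _

lemma memT_single_self {α : Fin k × Fin l} {f : C(Bidisk, ℂ)}
    (hf : f ∈ monoSpan (degSet k l 0 0)) : memT k l (single α α f) :=
  memT_single (by simpa using hf)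

lemma single_mul_mul_single (α β γ δ : Fin k × Fin l) (f g : C(Bidisk, ℂ)) (F : TM k l) :
    single α β f * F * single γ δ g = single α δ (f * entry F β γ * g) := by
  ext p : 1
  simp [single_apply, entry]

lemma sum_single_one : ∑ α, single α α 1 = (1 : TM k l) := by
  ext p : 1
  simp [single_apply, Matrix.sum_single_one]

lemma memT_one : memT k l 1 := by
  refine memT_iff.2 fun α β => ?_
  by_cases h : α = β
  · subst h
    have : entry (1 : TM k l) α α = 1 := by
      ext p
      simp [entry]
    rw [this, sub_self, sub_self]
    exact one_mem_monoSpan_degSet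
  · have : entry (1 : TM k l) α β = 0 := by
      ext p
      simp [entry, h]
    rw [this]
    exact Submodule.zero_mem _

section Ideal

variable {J : Set (TM k l)}

/-- The ideal of the base algebra formed by the entries at `(α, α)` of a two-sided ideal. -/
def diagIdeal (hJ : IsIdealIn {F : TM k l | memT k l F} J) (α : Fin k × Fin l) :
    Ideal (baseAlgebra k l) where
  carrier := {f | single α α (f : C(Bidisk, ℂ)) ∈ J}
  add_mem' {f g} hf hg := by
    have h : single α α ((f + g : baseAlgebra k l) : C(Bidisk, ℂ)) =
        single α α (f : C(Bidisk, ℂ)) + single α α (g : C(Bidisk, ℂ)) := by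
      ext p : 1
      simp [single_apply, Matrix.single_add]
    exact (congrArg (· ∈ J) h).mpr (hJ.2.2.1 _ hf _ hg)
  zero_mem' := by
    have h : single α α ((0 : baseAlgebra k l) : C(Bidisk, ℂ)) = 0 := by
      ext p : 1
      simp [single_apply]
    exact (congrArg (· ∈ J) h).mpr hJ.2.1
  smul_mem' c f hf := by
    have h : single α α ((c • f : baseAlgebra k l) : C(Bidisk, ℂ)) =
        single α α (c : C(Bidisk, ℂ)) * single α α (f : C(Bidisk, ℂ)) := by
      ext p : 1
      simp [single_apply]
    exact (congrArg (· ∈ J) h).mpr (hJ.2.2.2.2 _ (memT_single_self c.2) _ hf).1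

lemma exists_diagIdeal_ne_top (hJ : IsIdealIn {F : TM k l | memT k l F} J)
    (hne : J ≠ {F : TM k l | memT k l F}) : ∃ α, diagIdeal hJ α ≠ ⊤ := by
  by_contra! h
  have h1 : (1 : TM k l) ∈ J := by
    rw [← sum_single_one]
    exact Finset.sum_induction _ (· ∈ J) (fun _ _ ha hb => hJ.2.2.1 _ ha _ hb) hJ.2.1
      fun α _ => (Ideal.eq_top_iff_one _).1 (h α)
  exact hne (hJ.1.antisymm fun F hF => by simpa using (hJ.2.2.2.2 F hF 1 h1).1)

lemma exists_nat_modEq (hk : k ≠ 0) (d : ℤ) :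
    ∃ m : ℕ, (m : ℤ) ≡ d [ZMOD k] ∧ (d = 0 → m = 0) := by
  refine ⟨(d % k).toNat, ?_, fun h => by simp [h]⟩
  rw [Int.toNat_of_nonneg (Int.emod_nonneg _ (by exact_mod_cast hk))]
  exact Int.mod_modEq _ _

/-- The indices that the monomials nonvanishing at `p` connect to `α`. -/
def block (α : Fin k × Fin l) (p : Bidisk) : Set (Fin k × Fin l) :=
  {β | ((p : ℂ × ℂ).1 = 0 → β.1 = α.1) ∧ ((p : ℂ × ℂ).2 = 0 → β.2 = α.2)}

lemma self_mem_block (α : Fin k × Fin l) (p : Bidisk) : α ∈ block α p :=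
  ⟨fun _ => rfl, fun _ => rfl⟩

lemma exists_mono_ne_zero (hk : k ≠ 0) (hl : l ≠ 0) (p : Bidisk) {d e : ℤ}
    (hd : (p : ℂ × ℂ).1 = 0 → d = 0) (he : (p : ℂ × ℂ).2 = 0 → e = 0) :
    ∃ f ∈ monoSpan (degSet k l d e), f p ≠ 0 := by
  obtain ⟨m, hm, hm0⟩ := exists_nat_modEq hk d
  obtain ⟨n, hn, hn0⟩ := exists_nat_modEq hl e
  refine ⟨mono m n, mono_mem_monoSpan ⟨hm, hn⟩, mul_ne_zero ?_ ?_⟩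
  · by_cases h : (p : ℂ × ℂ).1 = 0
    · simp [hm0 (hd h)]
    · exact pow_ne_zero _ h
  · by_cases h : (p : ℂ × ℂ).2 = 0
    · simp [hn0 (he h)]
    · exact pow_ne_zero _ h

lemma exists_block_vanishing (hk : k ≠ 0) (hl : l ≠ 0)
    (hJ : IsIdealIn {F : TM k l | memT k l F} J) (hne : J ≠ {F : TM k l | memT k l F}) :
    ∃ α p, ∀ F ∈ J, ∀ β ∈ block α p, ∀ γ ∈ block α p, F p β γ = 0 := by
  obtain ⟨α, hα⟩ := exists_diagIdeal_ne_top hJ hne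
  obtain ⟨p, hp⟩ := exists_common_zero hk hl hα
  refine ⟨α, p, fun F hF β hβ γ hγ => ?_⟩
  obtain ⟨f, hf, hfp⟩ := exists_mono_ne_zero hk hl p
    (d := (α.1 : ℤ) - β.1) (e := (α.2 : ℤ) - β.2)
    (fun h => by rw [hβ.1 h, sub_self]) (fun h => by rw [hβ.2 h, sub_self])
  obtain ⟨g, hg, hgp⟩ := exists_mono_ne_zero hk hl p
    (d := (γ.1 : ℤ) - α.1) (e := (γ.2 : ℤ) - α.2)
    (fun h => by rw [hγ.1 h, sub_self]) (fun h => by rw [hγ.2 h, sub_self])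
  have hmem : single α α (f * entry F β γ * g) ∈ J := by
    rw [← single_mul_mul_single]
    exact (hJ.2.2.2.2 _ (memT_single hg) _ (hJ.2.2.2.2 _ (memT_single hf) _ hF).1).2
  have hbase : f * entry F β γ * g ∈ baseAlgebra k l := by
    have := memT_iff.1 (hJ.1 hmem) α α
    rwa [entry_single_same, sub_self, sub_self] at this
  have h0 : f p * F p β γ * g p = 0 := hp ⟨_, hbase⟩ hmem
  simpa [hfp, hgp] using h0

lemma fin_eq_of_zero_modEq {i j : Fin k} (h : (0 : ℤ) ≡ (i : ℤ) - j [ZMOD k]) : i = j := by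
  have h1 : (j : ℤ) ≡ i [ZMOD k] := by simpa using h.add_right (j : ℤ)
  have h2 := Nat.ModEq.eq_of_lt_of_lt (Int.natCast_modEq_iff.1 h1) j.2 i.2
  exact Fin.ext h2.symm

lemma apply_eq_zero_of_fst {F : TM k l} (hF : memT k l F) {p : Bidisk}
    (hp : (p : ℂ × ℂ).1 = 0) {β γ : Fin k × Fin l} (h : β.1 ≠ γ.1) : F p β γ = 0 := by
  have hle : monoSpan (degSet k l ((β.1 : ℤ) - γ.1) ((β.2 : ℤ) - γ.2)) ≤
      LinearMap.ker (ContinuousMap.evalCLM ℂ p).toLinearMap := by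
    refine monoSpan_le (ContinuousLinearMap.isClosed_ker _) fun m n hmn => ?_
    have hm : m ≠ 0 := by
      rintro rfl
      exact h (fin_eq_of_zero_modEq hmn.1)
    simp [mono_apply, hp, hm]
  exact hle (memT_iff.1 hF β γ)

lemma apply_eq_zero_of_snd {F : TM k l} (hF : memT k l F) {p : Bidisk}
    (hp : (p : ℂ × ℂ).2 = 0) {β γ : Fin k × Fin l} (h : β.2 ≠ γ.2) : F p β γ = 0 := by
  have hle : monoSpan (degSet k l ((β.1 : ℤ) - γ.1) ((β.2 : ℤ) - γ.2)) ≤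
      LinearMap.ker (ContinuousMap.evalCLM ℂ p).toLinearMap := by
    refine monoSpan_le (ContinuousLinearMap.isClosed_ker _) fun m n hmn => ?_
    have hn : n ≠ 0 := by
      rintro rfl
      exact h (fin_eq_of_zero_modEq hmn.2)
    simp [mono_apply, hp, hn]
  exact hle (memT_iff.1 hF β γ)

lemma apply_eq_zero_of_mem_of_notMem {F : TM k l} (hF : memT k l F) {p : Bidisk}
    {α β γ : Fin k × Fin l} (hβ : β ∈ block α p) (hγ : γ ∉ block α p) :
    F p β γ = 0 ∧ F p γ β = 0 := by
  rw [block, Set.mem_ofPred_eq, not_and_or] at hγ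
  push Not at hγ
  rcases hγ with ⟨hp, h⟩ | ⟨hp, h⟩
  · rw [← hβ.1 hp] at h
    exact ⟨apply_eq_zero_of_fst hF hp h.symm, apply_eq_zero_of_fst hF hp h⟩
  · rw [← hβ.2 hp] at h
    exact ⟨apply_eq_zero_of_snd hF hp h.symm, apply_eq_zero_of_snd hF hp h⟩

/-- The elements of `T_{k,l}` whose compression to the block of `α` vanishes at `p`. -/
def blockKer (α : Fin k × Fin l) (p : Bidisk) : Set (TM k l) :=
  {F | memT k l F ∧ ∀ β ∈ block α p, ∀ γ ∈ block α p, F p β γ = 0}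

lemma isIdealIn_blockKer (α : Fin k × Fin l) (p : Bidisk) :
    IsIdealIn {F : TM k l | memT k l F} (blockKer α p) := by
  refine ⟨fun F hF => hF.1, ⟨memT_zero, fun _ _ _ _ => rfl⟩,
    fun F hF G hG => ⟨memT_add hF.1 hG.1, fun β hβ γ hγ => ?_⟩,
    fun F hF => ⟨memT_neg hF.1, fun β hβ γ hγ => ?_⟩, fun F hF G hG =>
    ⟨⟨memT_mul hF hG.1, fun β hβ γ hγ => ?_⟩, ⟨memT_mul hG.1 hF, fun β hβ γ hγ => ?_⟩⟩⟩
  · simp [hF.2 β hβ γ hγ, hG.2 β hβ γ hγ]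
  · simp [hF.2 β hβ γ hγ]
  all_goals
    rw [ContinuousMap.mul_apply, Matrix.mul_apply]
    refine Finset.sum_eq_zero fun δ _ => ?_
    by_cases hδ : δ ∈ block α p
  · rw [hG.2 δ hδ γ hγ, mul_zero]
  · rw [(apply_eq_zero_of_mem_of_notMem hF hβ hδ).1, zero_mul]
  · rw [hG.2 β hβ δ hδ, zero_mul]
  · rw [(apply_eq_zero_of_mem_of_notMem hF hγ hδ).2, mul_zero]

lemma exists_eq_blockKer (hk : k ≠ 0) (hl : l ≠ 0)
    (hJ : IsMaxIdealIn {F : TM k l | memT k l F} J) : ∃ α p, J = blockKer α p := by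
  obtain ⟨α, p, hαp⟩ := exists_block_vanishing hk hl hJ.1 hJ.2.1
  refine ⟨α, p, ?_⟩
  rcases hJ.2.2 _ (isIdealIn_blockKer α p) fun F hF => ⟨hJ.1.1 hF, hαp F hF⟩ with h | h
  · exact h.symm
  · have h1 : (1 : TM k l) ∈ blockKer α p := h ▸ memT_one
    simpa using h1.2 α (self_mem_block α p) α (self_mem_block α p)

end Ideal

end Bidisk

/-- every maximal proper two-sided ideal of `T_{k,ℓ}` is the kernel of one of
the homomorphisms `ψ₀₀^{i₀i₀'}`, `ψ_{0μ}^{i₀}` (μ ≠ 0), `ψ_{λ0}^{i₀'}` (λ ≠ 0), or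
`ψ_{λμ}` (λ, μ ≠ 0). -/
theorem stmt12 (k l : ℕ) (hk : 1 ≤ k) (hl : 1 ≤ l) (J : Set (TM k l))
    (hJ : IsMaxIdealIn {F : TM k l | memT k l F} J) :
    (∃ (i₀ : Fin k) (i₀' : Fin l),
      J = {F : TM k l | memT k l F ∧ psiA k l i₀ i₀' F = 0}) ∨
    (∃ (i₀ : Fin k) (p : Bidisk), (p : ℂ × ℂ).1 = 0 ∧ (p : ℂ × ℂ).2 ≠ 0 ∧
      J = {F : TM k l | memT k l F ∧ psiB k l i₀ p F = 0}) ∨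
    (∃ (i₀' : Fin l) (p : Bidisk), (p : ℂ × ℂ).1 ≠ 0 ∧ (p : ℂ × ℂ).2 = 0 ∧
      J = {F : TM k l | memT k l F ∧ psiC k l i₀' p F = 0}) ∨
    (∃ p : Bidisk, (p : ℂ × ℂ).1 ≠ 0 ∧ (p : ℂ × ℂ).2 ≠ 0 ∧
      J = {F : TM k l | memT k l F ∧ psiD k l p F = 0}) := by
  obtain ⟨⟨i₀, i₀'⟩, p, rfl⟩ :=
    Bidisk.exists_eq_blockKer (Nat.one_le_iff_ne_zero.1 hk) (Nat.one_le_iff_ne_zero.1 hl) hJ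
  by_cases hz : (p : ℂ × ℂ).1 = 0 <;> by_cases hw : (p : ℂ × ℂ).2 = 0
  · obtain rfl : p = pt0 := Subtype.ext (Prod.ext hz hw)
    exact .inl ⟨i₀, i₀', by ext F; simp [Bidisk.blockKer, Bidisk.block, psiA, hz, hw]⟩
  · refine .inr (.inl ⟨i₀, p, hz, hw, ?_⟩)
    ext F
    simp [Bidisk.blockKer, Bidisk.block, psiB, hz, hw, ← Matrix.ext_iff]
    grind
  · refine .inr (.inr (.inl ⟨i₀', p, hz, hw, ?_⟩))
    ext F
    simp [Bidisk.blockKer, Bidisk.block, psiC, hz, hw, ← Matrix.ext_iff]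
  · refine .inr (.inr (.inr ⟨p, hz, hw, ?_⟩))
    ext F
    simp [Bidisk.blockKer, Bidisk.block, psiD, hz, hw, ← Matrix.ext_iff]
end
end

section
/- Let k, ℓ ≥ 2. There exist maximal proper two-sided ideals J of T_{k,ℓ} with dim_ℂ(T_{k,ℓ}/J) equal to 1, to k², to ℓ², and to k²ℓ². In particular, the set of codimensions of maximal two-sided ideals of T_{k,ℓ} contains at least three distinct values. -/
noncomputable section

/-- The quotient of (the subalgebra with carrier) `S` by the ideal `J` has complex
dimension `d`: there are `d` elements of `S` whose classes mod `J` form a basis, i.e.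
every `F ∈ S` is congruent mod `J` to a unique `ℂ`-linear combination of them. -/
def HasCodimIn {R : Type*} [Ring R] [Module ℂ R] (S J : Set R) (d : ℕ) : Prop :=
  ∃ g : Fin d → R, (∀ m : Fin d, g m ∈ S) ∧
    ∀ F ∈ S, ∃! c : Fin d → ℂ, F - ∑ m : Fin d, c m • g m ∈ J

/-- `g` has a power series expansion whose exponents are congruent to `r` mod `k` in the first
variable and to `s` mod `l` in the second. -/
def HasGradedCoeffs (k l : ℕ) (r s : ℤ) (g : Bidisk → ℂ) : Prop :=
  ∃ a : ℕ → ℕ → ℂ, HasCoeffsAt g a ∧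
    ∀ m n : ℕ, ¬ (Int.ModEq (k : ℤ) (m : ℤ) r ∧ Int.ModEq (l : ℤ) (n : ℤ) s) → a m n = 0

namespace HasGradedCoeffs

variable {k l : ℕ} {r s r' s' : ℤ} {f g : Bidisk → ℂ}

theorem zero : HasGradedCoeffs k l r s 0 :=
  ⟨fun _ _ => 0, fun _ _ _ => by simp, fun _ _ _ => rfl⟩

theorem add (hf : HasGradedCoeffs k l r s f) (hg : HasGradedCoeffs k l r s g) :
    HasGradedCoeffs k l r s (f + g) := by
  obtain ⟨a, ha, ha'⟩ := hf
  obtain ⟨b, hb, hb'⟩ := hg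
  refine ⟨fun m n => a m n + b m n, fun p h1 h2 => ?_, fun m n h => ?_⟩
  · simpa only [add_mul] using! (ha p h1 h2).add (hb p h1 h2)
  · simp [ha' m n h, hb' m n h]

theorem sum {ι : Type*} {t : Finset ι} {F : ι → Bidisk → ℂ}
    (h : ∀ i ∈ t, HasGradedCoeffs k l r s (F i)) : HasGradedCoeffs k l r s (∑ i ∈ t, F i) :=
  Finset.sum_induction F (HasGradedCoeffs k l r s) (fun _ _ => add) zero h

theorem mul (hf : HasGradedCoeffs k l r s f) (hg : HasGradedCoeffs k l r' s' g) :
    HasGradedCoeffs k l (r + r') (s + s') (f * g) := by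
  obtain ⟨a, ha, ha'⟩ := hf
  obtain ⟨b, hb, hb'⟩ := hg
  let deg : (ℕ × ℕ) × (ℕ × ℕ) → ℕ × ℕ := fun x => x.1 + x.2
  refine ⟨fun m n => ∑' x : deg ⁻¹' {(m, n)}, a x.1.1.1 x.1.1.2 * b x.1.2.1 x.1.2.2,
    fun p h1 h2 => ?_, fun m n h => ?_⟩
  · have hA := ha p h1 h2
    have hB := hb p h1 h2
    have hs := summable_mul_of_summable_norm hA.summable.norm hB.summable.norm
    convert! (hA.mul hB hs).tsum_fiberwise deg using 1
    funext mn
    rw [← tsum_mul_right, ← tsum_mul_right]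
    refine tsum_congr fun ⟨x, (hx : deg x = mn)⟩ => ?_
    subst hx
    simp only [deg, Prod.fst_add, Prod.snd_add, pow_add]
    ring
  · rw [← tsum_zero (β := deg ⁻¹' {(m, n)})]
    refine tsum_congr fun x => ?_
    have hx : deg x.1 = (m, n) := x.2
    obtain ⟨hm, hn⟩ := Prod.ext_iff.mp hx
    simp only [deg, Prod.fst_add, Prod.snd_add] at hm hn
    by_cases hx1 : Int.ModEq (k : ℤ) (x.1.1.1 : ℤ) r ∧ Int.ModEq (l : ℤ) (x.1.1.2 : ℤ) s
    · rw [hb', mul_zero]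
      rintro ⟨h3, h4⟩
      refine h ⟨?_, ?_⟩
      · rw [← hm]; push_cast; exact hx1.1.add h3
      · rw [← hn]; push_cast; exact hx1.2.add h4
    · rw [ha' _ _ hx1, zero_mul]

theorem monomial (c : ℂ) (m n : ℕ) (hm : Int.ModEq (k : ℤ) (m : ℤ) r)
    (hn : Int.ModEq (l : ℤ) (n : ℤ) s) :
    HasGradedCoeffs k l r s fun p => c * (p : ℂ × ℂ).1 ^ m * (p : ℂ × ℂ).2 ^ n := by
  refine ⟨fun m' n' => if m' = m ∧ n' = n then c else 0, fun p _ _ => ?_, fun m' n' h => ?_⟩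
  · convert hasSum_single (m, n) ?_ using 1
    · simp
    · rintro ⟨m', n'⟩ h
      have h' : ¬ (m' = m ∧ n' = n) := by simpa using h
      simp [h']
  · refine if_neg ?_
    rintro ⟨rfl, rfl⟩
    exact h ⟨hm, hn⟩

theorem const (c : ℂ) : HasGradedCoeffs k l 0 0 fun _ => c := by
  simpa using monomial (k := k) (l := l) c 0 0 (by simp [Int.ModEq]) (by simp [Int.ModEq])

theorem apply_eq_zero (hf : HasGradedCoeffs k l r s f) (p : Bidisk)
    (h1 : ‖(p : ℂ × ℂ).1‖ < 1) (h2 : ‖(p : ℂ × ℂ).2‖ < 1)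
    (h : ((p : ℂ × ℂ).1 = 0 ∧ ¬ Int.ModEq (k : ℤ) 0 r) ∨
      ((p : ℂ × ℂ).2 = 0 ∧ ¬ Int.ModEq (l : ℤ) 0 s)) : f p = 0 := by
  obtain ⟨a, ha, ha'⟩ := hf
  refine (ha p h1 h2).unique ?_
  convert hasSum_zero using 1
  funext ⟨m, n⟩
  rcases h with ⟨hp, h⟩ | ⟨hp, h⟩
  · rcases eq_or_ne m 0 with rfl | hm
    · simp [ha' 0 n fun h' => h (by simpa using h'.1)]
    · simp [hp, hm]
  · rcases eq_or_ne n 0 with rfl | hn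
    · simp [ha' m 0 fun h' => h (by simpa using h'.2)]
    · simp [hp, hn]

end HasGradedCoeffs

theorem memT_iff {k l : ℕ} {F : TM k l} : memT k l F ↔ ∀ x y : Fin k × Fin l,
    HasGradedCoeffs k l ((x.1 : ℤ) - (y.1 : ℤ)) ((x.2 : ℤ) - (y.2 : ℤ)) fun p => F p x y :=
  ⟨fun h x y => h x.1 y.1 x.2 y.2, fun h i j i' j' => h (i, i') (j, j')⟩

/-- The algebra `T_{k,ℓ}`. -/
def algT (k l : ℕ) : Subalgebra ℂ (TM k l) where
  carrier := {F | memT k l F}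
  add_mem' {F G} hF hG := memT_iff.mpr fun x y => (memT_iff.mp hF x y).add (memT_iff.mp hG x y)
  mul_mem' {F G} hF hG := memT_iff.mpr fun x y => by
    have := HasGradedCoeffs.sum (t := Finset.univ) fun z _ => by
      simpa using (memT_iff.mp hF x z).mul (memT_iff.mp hG z y)
    convert this using 1
    funext p
    simp [Matrix.mul_apply]
  algebraMap_mem' c := memT_iff.mpr fun x y => by
    rcases eq_or_ne x y with rfl | h
    · simpa [_root_.algebraMap_apply, Matrix.smul_apply] using
        HasGradedCoeffs.const (k := k) (l := l) c
    · simpa [_root_.algebraMap_apply, Matrix.smul_apply, h] using!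
        HasGradedCoeffs.zero (k := k) (l := l)

/-- The function `(z, w) ↦ c z^m w^n E_{xy}`. -/
def monomialUnit (k l : ℕ) (x y : Fin k × Fin l) (c : ℂ) (m n : ℕ) : TM k l where
  toFun p := Matrix.single x y (c * (p : ℂ × ℂ).1 ^ m * (p : ℂ × ℂ).2 ^ n)
  continuous_toFun := by
    refine continuous_matrix fun i j => ?_
    simp only [Matrix.single_apply]
    split_ifs <;> fun_prop

theorem monomialUnit_mem {k l : ℕ} {x y : Fin k × Fin l} (c : ℂ) {m n : ℕ}
    (hm : Int.ModEq (k : ℤ) (m : ℤ) ((x.1 : ℤ) - (y.1 : ℤ)))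
    (hn : Int.ModEq (l : ℤ) (n : ℤ) ((x.2 : ℤ) - (y.2 : ℤ))) :
    monomialUnit k l x y c m n ∈ algT k l := memT_iff.mpr fun x' y' => by
  by_cases h : x = x' ∧ y = y'
  · obtain ⟨rfl, rfl⟩ := h
    simpa [monomialUnit] using HasGradedCoeffs.monomial c m n hm hn
  · simpa [monomialUnit, Matrix.single_apply, h] using! HasGradedCoeffs.zero (k := k) (l := l)

theorem Fin.not_zero_modEq_sub {k : ℕ} {i j : Fin k} (h : i ≠ j) :
    ¬ Int.ModEq (k : ℤ) 0 ((i : ℤ) - (j : ℤ)) := fun h' => h <| Fin.ext <| by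
  have h1 : Int.ModEq (k : ℤ) j i := by simpa using h'.add_right (j : ℤ)
  have h2 := Int.natCast_modEq_iff.mp h1
  exact (Nat.ModEq.eq_of_lt_of_lt h2 j.2 i.2).symm

/-- There is an exponent in the residue class of `i - j` at which `z ↦ z ^ m` does not vanish at
`z`, provided `z ≠ 0` or `i = j`. -/
theorem Fin.exists_modEq_sub_pow_ne_zero {k : ℕ} (i j : Fin k) {z : ℂ} (h : i = j ∨ z ≠ 0) :
    ∃ m : ℕ, Int.ModEq (k : ℤ) (m : ℤ) ((i : ℤ) - (j : ℤ)) ∧ z ^ m ≠ 0 := by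
  rcases h with rfl | h
  · exact ⟨0, by simp [Int.ModEq], by simp⟩
  · refine ⟨i + (k - j), ?_, pow_ne_zero _ h⟩
    have := j.2.le
    push_cast [this]
    refine Int.modEq_iff_dvd.mpr ⟨-1, by ring⟩

/-- A surjective homomorphism onto a finite-dimensional simple algebra has a maximal kernel, of
codimension the dimension of the target. -/
theorem exists_isMaxIdealIn_hasCodimIn {R A : Type*} [Ring R] [Algebra ℂ R] [Ring A] [Algebra ℂ A]
    [IsSimpleRing A] [FiniteDimensional ℂ A] (S : Subalgebra ℂ R) (φ : S →ₐ[ℂ] A)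
    (hφ : Function.Surjective φ) :
    ∃ J : Set R, IsMaxIdealIn (S : Set R) J ∧
      HasCodimIn (S : Set R) J (Module.finrank ℂ A) := by
  let J : Set R := {x | ∃ h : x ∈ S, φ ⟨x, h⟩ = 0}
  have mem_J (x : S) : (x : R) ∈ J ↔ φ x = 0 := ⟨fun h => h.2, fun h => ⟨x.2, h⟩⟩
  refine ⟨J, ⟨⟨fun x hx => hx.1, (mem_J 0).mpr (map_zero φ), ?_, ?_, ?_⟩, ?_, ?_⟩, ?_⟩
  · rintro f ⟨hf, hf'⟩ g ⟨hg, hg'⟩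
    exact (mem_J (⟨f, hf⟩ + ⟨g, hg⟩)).mpr (by rw [map_add, hf', hg', add_zero])
  · rintro f ⟨hf, hf'⟩
    exact (mem_J (-⟨f, hf⟩)).mpr (by rw [map_neg, hf', neg_zero])
  · rintro f hf g ⟨hg, hg'⟩
    exact ⟨(mem_J (⟨f, hf⟩ * ⟨g, hg⟩)).mpr (by rw [map_mul, hg', mul_zero]),
      (mem_J (⟨g, hg⟩ * ⟨f, hf⟩)).mpr (by rw [map_mul, hg', zero_mul])⟩
  · intro h
    have h1 : ((1 : S) : R) ∈ J := h ▸ S.one_mem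
    rw [mem_J, map_one] at h1
    exact one_ne_zero h1
  · rintro J' ⟨hS, h0, hadd, hneg, hmul⟩ hJ
    let I : TwoSidedIdeal A := TwoSidedIdeal.mk' {a | ∃ f : S, (f : R) ∈ J' ∧ φ f = a}
      ⟨0, h0, map_zero φ⟩
      (by
        rintro _ _ ⟨f, hf, rfl⟩ ⟨g, hg, rfl⟩
        exact ⟨f + g, hadd _ hf _ hg, map_add φ f g⟩)
      (by
        rintro _ ⟨f, hf, rfl⟩
        exact ⟨-f, hneg _ hf, map_neg φ f⟩)
      (by
        rintro a _ ⟨g, hg, rfl⟩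
        obtain ⟨f, rfl⟩ := hφ a
        exact ⟨f * g, (hmul _ f.2 _ hg).1, map_mul φ f g⟩)
      (by
        rintro _ a ⟨g, hg, rfl⟩
        obtain ⟨f, rfl⟩ := hφ a
        exact ⟨g * f, (hmul _ f.2 _ hg).2, map_mul φ g f⟩)
    have mem_I (a : A) : a ∈ I ↔ ∃ f : S, (f : R) ∈ J' ∧ φ f = a :=
      TwoSidedIdeal.mem_mk' _ _ _ _ _ _ a
    by_cases h : ∀ f : S, (f : R) ∈ J' → φ f = 0
    · exact Or.inl (Set.Subset.antisymm (fun x hx => ⟨hS hx, h ⟨x, hS hx⟩ hx⟩) hJ)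
    · push Not at h
      obtain ⟨f, hf, hf0⟩ := h
      obtain ⟨e, he, he1⟩ := (mem_I 1).mp
        (IsSimpleRing.one_mem_of_ne_zero_mem I hf0 ((mem_I _).mpr ⟨f, hf, rfl⟩))
      refine Or.inr (Set.Subset.antisymm hS fun x hx => ?_)
      have h1 : ((⟨x, hx⟩ - e * ⟨x, hx⟩ : S) : R) ∈ J' :=
        hJ ((mem_J _).mpr (by rw [map_sub, map_mul, he1, one_mul, sub_self]))
      simpa using hadd _ h1 _ (hmul x hx _ he).2
  · let b := Module.finBasis ℂ A
    choose g hg using fun m => hφ (b m)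
    refine ⟨fun m => g m, fun m => (g m).2, fun F hF => ?_⟩
    have key (c : Fin (Module.finrank ℂ A) → ℂ) :
        F - ∑ m, c m • (g m : R) ∈ J ↔ φ ⟨F, hF⟩ = ∑ m, c m • b m := by
      rw [← sub_eq_zero]
      convert mem_J (⟨F, hF⟩ - ∑ m, c m • g m) using 2
      · simp
      · simp [hg]
    refine ⟨b.repr (φ ⟨F, hF⟩), (key _).mpr (b.sum_repr _).symm, fun c hc => ?_⟩
    funext m
    rw [(key c).mp hc, b.repr_sum_self]

/-- Compression of the evaluation at `p` to the block of indices in the range of `e`. -/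
def blockEval {k l : ℕ} {n : Type*} [Fintype n] [DecidableEq n] (e : n → Fin k × Fin l)
    (he : Function.Injective e) (p : Bidisk)
    (h : ∀ F ∈ algT k l, ∀ x, ∀ y ∉ Set.range e, F p (e x) y = 0) :
    algT k l →ₐ[ℂ] Matrix n n ℂ where
  toFun F := (F.1 p).submatrix e e
  map_one' := Matrix.submatrix_one e he
  map_mul' F G := by
    ext x y
    simp only [Subalgebra.coe_mul, ContinuousMap.mul_apply, Matrix.submatrix_apply,
      Matrix.mul_apply]
    exact (Fintype.sum_of_injective e he _ _ (fun z hz => by simp [h F.1 F.2 x z hz])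
      fun _ => rfl).symm
  map_zero' := rfl
  map_add' _ _ := rfl
  commutes' c := by
    ext x y
    simp [_root_.algebraMap_apply, Matrix.algebraMap_matrix_apply, Matrix.one_apply,
      he.eq_iff]

theorem exists_isMaxIdealIn_hasCodimIn_of_block {k l : ℕ} {n : Type*} [Fintype n] [DecidableEq n]
    [Nonempty n] (e : n → Fin k × Fin l) (he : Function.Injective e) (z w : ℂ) (hz : ‖z‖ < 1)
    (hw : ‖w‖ < 1)
    (hrange : ∀ x y, ((e x).1 = (e y).1 ∨ z ≠ 0) ∧ ((e x).2 = (e y).2 ∨ w ≠ 0))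
    (hcompl : ∀ x, ∀ y ∉ Set.range e, (z = 0 ∧ (e x).1 ≠ y.1) ∨ (w = 0 ∧ (e x).2 ≠ y.2)) :
    ∃ J : Set (TM k l), IsMaxIdealIn {F : TM k l | memT k l F} J ∧
      HasCodimIn {F : TM k l | memT k l F} J (Fintype.card n ^ 2) := by
  let p : Bidisk := ⟨(z, w), by simp [Bidisk, hz.le, hw.le]⟩
  let φ := blockEval e he p fun F hF x y hy =>
    (memT_iff.mp hF (e x) y).apply_eq_zero p hz hw <|
      (hcompl x y hy).imp (And.imp_right Fin.not_zero_modEq_sub)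
        (And.imp_right Fin.not_zero_modEq_sub)
  have single_mem (x y : n) (c : ℂ) : Matrix.single x y c ∈ φ.range := by
    obtain ⟨a, ha, ha0⟩ := Fin.exists_modEq_sub_pow_ne_zero _ _ (hrange x y).1
    obtain ⟨b, hb, hb0⟩ := Fin.exists_modEq_sub_pow_ne_zero _ _ (hrange x y).2
    refine ⟨⟨_, monomialUnit_mem (c * (z ^ a)⁻¹ * (w ^ b)⁻¹) ha hb⟩, ?_⟩
    have hc : c * (z ^ a)⁻¹ * (w ^ b)⁻¹ * z ^ a * w ^ b = c := by field_simp
    ext x' y'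
    change Matrix.single (e x) (e y) (c * (z ^ a)⁻¹ * (w ^ b)⁻¹ * z ^ a * w ^ b) (e x') (e y') = _
    simp [Matrix.single_apply, he.eq_iff, hc]
  have hφ : Function.Surjective φ := fun M => by
    rw [Matrix.matrix_eq_sum_single M]
    exact sum_mem fun x _ => sum_mem fun y _ => single_mem x y _
  have := exists_isMaxIdealIn_hasCodimIn (algT k l) φ hφ
  rwa [Module.finrank_matrix, Module.finrank_self, mul_one, ← sq] at this

/-- for `k, ℓ ≥ 2`, `T_{k,ℓ}` has maximal two-sided ideals of codimension
`1`, `k²`, `ℓ²` and `k²ℓ²`; in particular the set of codimensions of maximal two-sided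
ideals of `T_{k,ℓ}` contains at least three distinct values. -/
theorem stmt14 (k l : ℕ) (hk : 2 ≤ k) (hl : 2 ≤ l) :
    (∃ J : Set (TM k l), IsMaxIdealIn {F : TM k l | memT k l F} J ∧
      HasCodimIn {F : TM k l | memT k l F} J 1) ∧
    (∃ J : Set (TM k l), IsMaxIdealIn {F : TM k l | memT k l F} J ∧
      HasCodimIn {F : TM k l | memT k l F} J (k ^ 2)) ∧
    (∃ J : Set (TM k l), IsMaxIdealIn {F : TM k l | memT k l F} J ∧
      HasCodimIn {F : TM k l | memT k l F} J (l ^ 2)) ∧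
    (∃ J : Set (TM k l), IsMaxIdealIn {F : TM k l | memT k l F} J ∧
      HasCodimIn {F : TM k l | memT k l F} J (k ^ 2 * l ^ 2)) ∧
    (∃ d₁ d₂ d₃ : ℕ, d₁ ≠ d₂ ∧ d₁ ≠ d₃ ∧ d₂ ≠ d₃ ∧
      (∃ J : Set (TM k l), IsMaxIdealIn {F : TM k l | memT k l F} J ∧
        HasCodimIn {F : TM k l | memT k l F} J d₁) ∧
      (∃ J : Set (TM k l), IsMaxIdealIn {F : TM k l | memT k l F} J ∧
        HasCodimIn {F : TM k l | memT k l F} J d₂) ∧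
      (∃ J : Set (TM k l), IsMaxIdealIn {F : TM k l | memT k l F} J ∧
        HasCodimIn {F : TM k l | memT k l F} J d₃)) := by
  have hhalf : ‖(1 / 2 : ℂ)‖ < 1 := by norm_num
  have hzero : ‖(0 : ℂ)‖ < 1 := by simp
  have : NeZero k := ⟨by omega⟩
  have : NeZero l := ⟨by omega⟩
  have hA := exists_isMaxIdealIn_hasCodimIn_of_block (k := k) (l := l)
    (fun _ : Unit => (0, 0)) (fun _ _ _ => rfl) 0 0 hzero hzero (by simp) (by
      rintro - ⟨i, i'⟩ h
      by_contra! h'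
      exact h ⟨(), Prod.ext (h'.1 rfl) (h'.2 rfl)⟩)
  have hB := exists_isMaxIdealIn_hasCodimIn_of_block (k := k) (l := l)
    (fun i' : Fin l => (0, i')) (Prod.mk_right_injective 0) 0 (1 / 2) hzero hhalf (by simp) (by
      rintro - ⟨i, i'⟩ h
      exact Or.inl ⟨rfl, fun hi => h ⟨i', Prod.ext hi rfl⟩⟩)
  have hC := exists_isMaxIdealIn_hasCodimIn_of_block (k := k) (l := l)
    (fun i : Fin k => (i, 0)) (Prod.mk_left_injective 0) (1 / 2) 0 hhalf hzero (by simp) (by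
      rintro - ⟨i, i'⟩ h
      exact Or.inr ⟨rfl, fun hi => h ⟨i, Prod.ext rfl hi⟩⟩)
  have hD := exists_isMaxIdealIn_hasCodimIn_of_block (k := k) (l := l)
    id Function.injective_id (1 / 2) (1 / 2) hhalf hhalf (by simp) (by simp)
  simp only [Fintype.card_unit, Fintype.card_fin, Fintype.card_prod, one_pow, mul_pow]
    at hA hB hC hD
  have hk' : 1 < k ^ 2 := Nat.one_lt_pow two_ne_zero hk
  have hl' : 1 < l ^ 2 := Nat.one_lt_pow two_ne_zero hl
  exact ⟨hA, hC, hB, hD, 1, k ^ 2, k ^ 2 * l ^ 2, by omega, by nlinarith, by nlinarith, hA, hC, hD⟩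
end
end

section
/- For all positive integers p, k, ℓ with k > 1 and ℓ > 1, the algebras B_{p,2} and T_{k,ℓ} are not isomorphic: there is no ℂ-algebra isomorphism between B_{p,2} and T_{k,ℓ}. -/
noncomputable section

/-- Membership in `B_{k,2}`: a continuous `M_k(ℂ)`-valued function on the closed bidisk whose
`(i,j)` entry is given on the open bidisk by a power series whose coefficients `a m n` vanish
unless `m + n ≡ i - j (mod k)`. -/
def memBk2 (k : ℕ) (F : C(Bidisk, Matrix (Fin k) (Fin k) ℂ)) : Prop :=
  ∀ i j : Fin k, ∃ a : ℕ → ℕ → ℂ,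
    HasCoeffsAt (fun p => F p i j) a ∧
    ∀ m n : ℕ, ¬ Int.ModEq (k : ℤ) ((m : ℤ) + (n : ℤ)) ((i : ℤ) - (j : ℤ)) → a m n = 0

namespace HasCoeffsAt

theorem sub {f g : Bidisk → ℂ} {a b : ℕ → ℕ → ℂ} (hf : HasCoeffsAt f a)
    (hg : HasCoeffsAt g b) : HasCoeffsAt (fun p => f p - g p) fun m n => a m n - b m n := by
  intro p h1 h2
  simpa only [sub_mul] using (hf p h1 h2).sub (hg p h1 h2)

instance instHasAntidiagonalNatProd : Finset.HasAntidiagonal (ℕ × ℕ) :=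
  Finset.HasAntidiagonal.antidiagonalOfLocallyFinite

theorem hasSum_antidiagonal {u v : ℕ × ℕ → ℂ} {s t : ℂ} (hu : HasSum u s) (hv : HasSum v t) :
    HasSum (fun n => ∑ x ∈ Finset.HasAntidiagonal.antidiagonal n, u x.1 * v x.2) (s * t) := by
  have huv := summable_mul_of_summable_norm hu.summable.norm hv.summable.norm
  have h := hu.summable.tsum_mul_tsum_eq_tsum_sum_antidiagonal hv.summable huv
  rw [hu.tsum_eq, hv.tsum_eq] at h
  rw [h]
  exact (summable_sum_mul_antidiagonal_of_summable_mul huv).hasSum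

theorem mul {f g : Bidisk → ℂ} {a b : ℕ → ℕ → ℂ} (hf : HasCoeffsAt f a)
    (hg : HasCoeffsAt g b) :
    HasCoeffsAt (fun p => f p * g p) fun m n =>
      ∑ x ∈ Finset.HasAntidiagonal.antidiagonal ((m, n) : ℕ × ℕ),
        a x.1.1 x.1.2 * b x.2.1 x.2.2 := by
  intro p h1 h2
  have H := hasSum_antidiagonal (hf p h1 h2) (hg p h1 h2)
  have key : ∀ mn : ℕ × ℕ, (∑ x ∈ Finset.HasAntidiagonal.antidiagonal mn,
      a x.1.1 x.1.2 * b x.2.1 x.2.2) * (p : ℂ × ℂ).1 ^ mn.1 * (p : ℂ × ℂ).2 ^ mn.2 =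
      ∑ x ∈ Finset.HasAntidiagonal.antidiagonal mn,
        a x.1.1 x.1.2 * (p : ℂ × ℂ).1 ^ x.1.1 * (p : ℂ × ℂ).2 ^ x.1.2 *
          (b x.2.1 x.2.2 * (p : ℂ × ℂ).1 ^ x.2.1 * (p : ℂ × ℂ).2 ^ x.2.2) := by
    intro mn
    rw [Finset.sum_mul, Finset.sum_mul]
    refine Finset.sum_congr rfl fun x hx => ?_
    rw [Finset.HasAntidiagonal.mem_antidiagonal] at hx
    rw [← hx, Prod.fst_add, Prod.snd_add]
    ring
  exact H.congr_fun key

theorem monomial (c : ℂ) (m n : ℕ) :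
    HasCoeffsAt (fun p => c * (p : ℂ × ℂ).1 ^ m * (p : ℂ × ℂ).2 ^ n)
      fun m' n' => if m' = m ∧ n' = n then c else 0 := by
  intro p _ _
  have := hasSum_single (f := fun mn : ℕ × ℕ => (if mn.1 = m ∧ mn.2 = n then c else 0) *
    (p : ℂ × ℂ).1 ^ mn.1 * (p : ℂ × ℂ).2 ^ mn.2) (m, n) (by
      rintro ⟨m', n'⟩ h
      have : ¬ (m' = m ∧ n' = n) := by simpa using h
      simp [this])
  simpa using this

/-- A function with power series coefficients is holomorphic in the first variable. -/
theorem differentiableOn {F : ℂ → ℂ} {a : ℕ → ℕ → ℂ} {w : ℂ}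
    (h : ∀ z : ℂ, ‖z‖ < 1 → HasSum (fun mn : ℕ × ℕ => a mn.1 mn.2 * z ^ mn.1 * w ^ mn.2) (F z)) :
    DifferentiableOn ℂ F (Metric.ball 0 1) := by
  intro z hz
  obtain ⟨r, hzr, hr⟩ := exists_between (mem_ball_zero_iff.mp hz)
  have hr0 : 0 ≤ r := (norm_nonneg z).trans hzr.le
  have hs := (h r (by simpa [abs_of_nonneg hr0] using hr)).summable.norm
  have hd := Complex.differentiableOn_tsum_of_summable_norm
    (F := fun (mn : ℕ × ℕ) (z : ℂ) => a mn.1 mn.2 * z ^ mn.1 * w ^ mn.2)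
    (U := Metric.ball 0 r) hs (fun i => by fun_prop) Metric.isOpen_ball (by
      intro i v hv
      rw [mem_ball_zero_iff] at hv
      simp only [norm_mul, norm_pow, Complex.norm_real, Real.norm_eq_abs, abs_of_nonneg hr0]
      gcongr)
  have hat : DifferentiableAt ℂ F z := by
    refine (hd.differentiableAt (Metric.isOpen_ball.mem_nhds (by simpa using hzr))).congr_of_eventuallyEq ?_
    filter_upwards [Metric.isOpen_ball.mem_nhds (show z ∈ Metric.ball (0 : ℂ) r by simpa using hzr)]
      with v hv
    exact ((h v ((mem_ball_zero_iff.mp hv).trans hr)).tsum_eq).symm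
  exact hat.differentiableWithinAt

theorem eq_zero_of_fst_eq_zero {q : Bidisk → ℂ} {a : ℕ → ℕ → ℂ} (h : HasCoeffsAt q a)
    (h0 : ∀ n, a 0 n = 0) {p : Bidisk} (hp : (p : ℂ × ℂ).1 = 0) (hp2 : ‖(p : ℂ × ℂ).2‖ < 1) :
    q p = 0 := by
  refine (h p (by simp [hp]) hp2).unique ?_
  convert hasSum_zero with mn
  rcases mn with ⟨_ | m, n⟩ <;> simp [h0, hp]

end HasCoeffsAt

theorem Bidisk.norm_fst_le_s15 (p : Bidisk) : ‖(p : ℂ × ℂ).1‖ ≤ 1 := by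
  simpa using p.2.1

theorem Bidisk.norm_snd_le_s15 (p : Bidisk) : ‖(p : ℂ × ℂ).2‖ ≤ 1 := by
  simpa using p.2.2

/-- Radial contraction of the bidisk. -/
def Bidisk.scale (t : unitInterval) (p : Bidisk) : Bidisk :=
  ⟨((t : ℝ) * (p : ℂ × ℂ).1, (t : ℝ) * (p : ℂ × ℂ).2), by
    have h1 := (Bidisk.norm_fst_le_s15 p)
    have h2 := (Bidisk.norm_snd_le_s15 p)
    have h3 := t.2.1
    have h4 := t.2.2
    simp only [Bidisk, Set.mem_prod, mem_closedBall_zero_iff, norm_mul, Complex.norm_real,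
      Real.norm_eq_abs, abs_of_nonneg h3]
    exact ⟨mul_le_one₀ h4 (norm_nonneg _) h1, mul_le_one₀ h4 (norm_nonneg _) h2⟩⟩

/-- Inequalities between continuous functions extend from the open to the closed bidisk. -/
theorem Bidisk.le_of_forall_open {u v : Bidisk → ℝ} (hu : Continuous u) (hv : Continuous v)
    (h : ∀ p : Bidisk, ‖(p : ℂ × ℂ).1‖ < 1 → ‖(p : ℂ × ℂ).2‖ < 1 → u p ≤ v p) (p : Bidisk) :
    u p ≤ v p := by
  have hc : Continuous fun t : unitInterval => Bidisk.scale t p := by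
    unfold Bidisk.scale
    fun_prop
  have hcl : IsClosed {t : unitInterval | u (Bidisk.scale t p) ≤ v (Bidisk.scale t p)} :=
    isClosed_le (hu.comp hc) (hv.comp hc)
  have hsub : Set.Iio (1 : unitInterval) ⊆
      {t : unitInterval | u (Bidisk.scale t p) ≤ v (Bidisk.scale t p)} := by
    intro t ht
    have ht1 : (t : ℝ) < 1 := ht
    have key : ∀ x : ℂ, ‖x‖ ≤ 1 → ‖((t : ℝ) : ℂ) * x‖ < 1 := by
      intro x hx
      rw [norm_mul, Complex.norm_real, Real.norm_eq_abs, abs_of_nonneg t.2.1]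
      nlinarith [t.2.1, norm_nonneg x]
    exact h _ (key _ (Bidisk.norm_fst_le_s15 p)) (key _ (Bidisk.norm_snd_le_s15 p))
  have hmem : (1 : unitInterval) ∈ closure (Set.Iio (1 : unitInterval)) := by
    rw [closure_Iio' ⟨0, zero_lt_one⟩]
    exact Set.self_mem_Iic
  have := closure_minimal hsub hcl hmem
  simpa [Bidisk.scale] using this

/-- Schwarz lemma in the first variable, up to the boundary of the bidisk. -/
theorem HasCoeffsAt.exists_norm_le {q : C(Bidisk, ℂ)} {a : ℕ → ℕ → ℂ} (h : HasCoeffsAt q a)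
    (h0 : ∀ n, a 0 n = 0) : ∃ C, 0 ≤ C ∧ ∀ p : Bidisk, ‖q p‖ ≤ C * ‖(p : ℂ × ℂ).1‖ := by
  refine ⟨‖q‖, norm_nonneg _, Bidisk.le_of_forall_open (by fun_prop) (by fun_prop) ?_⟩
  rintro ⟨⟨z, w⟩, hp⟩ hz hw
  simp only at hz hw
  have hmem : ∀ x : ℂ, ‖x‖ ≤ 1 → (x, w) ∈ Bidisk := fun x hx => by simpa [Bidisk, hx] using hw.le
  obtain ⟨F, hF⟩ : ∃ F : ℂ → ℂ, ∀ x (hx : ‖x‖ ≤ 1), F x = q ⟨(x, w), hmem x hx⟩ := by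
    classical
    exact ⟨fun x => if hx : ‖x‖ ≤ 1 then q ⟨(x, w), hmem x hx⟩ else 0, fun x hx => dif_pos hx⟩
  have hFz : ∀ x, ‖x‖ < 1 →
      HasSum (fun mn : ℕ × ℕ => a mn.1 mn.2 * x ^ mn.1 * w ^ mn.2) (F x) := by
    intro x hx
    rw [hF x hx.le]
    exact h ⟨(x, w), hmem x hx.le⟩ hx hw
  have hF0 : F 0 = 0 := by
    rw [hF 0 (by simp)]
    exact h.eq_zero_of_fst_eq_zero h0 (p := ⟨(0, w), hmem 0 (by simp)⟩) rfl hw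
  have hm : Set.MapsTo F (Metric.ball 0 1) (Metric.closedBall (F 0) ‖q‖) := by
    intro x hx
    rw [mem_ball_zero_iff] at hx
    rw [hF0, mem_closedBall_zero_iff]
    rw [hF x hx.le]
    exact q.norm_coe_le_norm _
  have := Complex.dist_le_div_mul_dist_of_mapsTo_ball
    (HasCoeffsAt.differentiableOn hFz) hm (mem_ball_zero_iff.mpr hz)
  rw [hF0, hF z hz.le] at this
  simpa using this

/-- If `q` vanishes on `z = 0`, then `q ^ 2` is divisible by `z`. -/
theorem HasCoeffsAt.exists_mul_self_eq {q : C(Bidisk, ℂ)} {a : ℕ → ℕ → ℂ} (h : HasCoeffsAt q a)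
    (h0 : ∀ n, a 0 n = 0) : ∃ g : C(Bidisk, ℂ),
      (∀ p : Bidisk, q p * q p = (p : ℂ × ℂ).1 * g p) ∧
      HasCoeffsAt g fun m n =>
        ∑ x ∈ Finset.HasAntidiagonal.antidiagonal ((m + 1, n) : ℕ × ℕ), a x.1.1 x.1.2 * a x.2.1 x.2.2 := by
  obtain ⟨C, hC0, hC⟩ := h.exists_norm_le h0
  have hz0 : ∀ p : Bidisk, (p : ℂ × ℂ).1 = 0 → q p = 0 := by
    intro p hp
    simpa [hp] using hC p
  set g : Bidisk → ℂ := fun p => q p * q p / (p : ℂ × ℂ).1 with hg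
  have hgc : Continuous g := by
    rw [continuous_iff_continuousAt]
    intro p
    by_cases hp : (p : ℂ × ℂ).1 = 0
    · have hgp : g p = 0 := by simp [hg, hp]
      rw [ContinuousAt, hgp]
      refine squeeze_zero_norm (a := fun x : Bidisk => C ^ 2 * ‖(x : ℂ × ℂ).1‖) (fun x => ?_) ?_
      · simp only [hg, norm_div, norm_mul]
        refine div_le_of_le_mul₀ (norm_nonneg _) (by positivity) ?_
        calc ‖q x‖ * ‖q x‖ ≤ (C * ‖(x : ℂ × ℂ).1‖) * (C * ‖(x : ℂ × ℂ).1‖) := by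
              gcongr <;> exact hC x
          _ = _ := by ring
      · have : Continuous fun x : Bidisk => C ^ 2 * ‖(x : ℂ × ℂ).1‖ := by fun_prop
        simpa [hp] using this.tendsto p
    · exact ContinuousAt.div (by fun_prop) (by fun_prop) hp
  have hmul : ∀ p : Bidisk, q p * q p = (p : ℂ × ℂ).1 * g p := by
    intro p
    by_cases hp : (p : ℂ × ℂ).1 = 0
    · simp [hp, hz0 p hp]
    · simp only [hg]; field_simp
  refine ⟨⟨g, hgc⟩, hmul, ?_⟩
  intro p h1 h2
  have hc0 : ∀ m n, m < 2 → ∑ x ∈ Finset.HasAntidiagonal.antidiagonal ((m, n) : ℕ × ℕ),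
      a x.1.1 x.1.2 * a x.2.1 x.2.2 = 0 := by
    intro m n hm
    refine Finset.sum_eq_zero fun x hx => ?_
    rw [Finset.HasAntidiagonal.mem_antidiagonal] at hx
    have h3 : x.1.1 + x.2.1 = m := congrArg Prod.fst hx
    obtain h4 | h4 : x.1.1 = 0 ∨ x.2.1 = 0 := by omega
    · simp [h4, h0]
    · simp [h4, h0]
  by_cases hp : (p : ℂ × ℂ).1 = 0
  · have : (ContinuousMap.mk g hgc) p = 0 := by simp [hg, hp]
    rw [this]
    convert hasSum_zero with mn
    rcases mn with ⟨_ | m, n⟩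
    · simp only [zero_add, hc0 1 n one_lt_two, zero_mul]
    · simp [hp]
  · have H := h.mul h p h1 h2
    simp only at H
    have hinj : Function.Injective fun mn : ℕ × ℕ => (mn.1 + 1, mn.2) := by
      rintro ⟨m, n⟩ ⟨m', n'⟩ he
      simpa using he
    rw [← hinj.hasSum_iff (by
      rintro ⟨_ | m, n⟩ hmn
      · simp only [hc0 0 n two_pos, zero_mul]
      · exact absurd ⟨(m, n), rfl⟩ hmn)] at H
    refine (H.div_const (p : ℂ × ℂ).1).congr_fun ?_
    rintro ⟨m, n⟩
    simp only [Function.comp_apply]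
    field_simp
    ring

/-- Functions on the bidisk whose power series is supported in total degrees congruent to `d`
modulo `p`. -/
def IsGraded (p : ℕ) (d : ℤ) (f : Bidisk → ℂ) : Prop :=
  ∃ a : ℕ → ℕ → ℂ, HasCoeffsAt f a ∧
    ∀ m n : ℕ, ¬ Int.ModEq (p : ℤ) ((m : ℤ) + (n : ℤ)) d → a m n = 0

theorem IsGraded.congr {p : ℕ} {d e : ℤ} {f : Bidisk → ℂ} (h : IsGraded p d f)
    (hde : Int.ModEq (p : ℤ) d e) : IsGraded p e f := by
  obtain ⟨a, ha, ha'⟩ := h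
  exact ⟨a, ha, fun m n hmn => ha' m n fun h' => hmn (h'.trans hde)⟩

theorem IsGraded.const_mul {p : ℕ} {d : ℤ} {f : Bidisk → ℂ} (h : IsGraded p d f) (c : ℂ) :
    IsGraded p d fun x => c * f x := by
  obtain ⟨a, ha, ha'⟩ := h
  refine ⟨fun m n => c * a m n, fun x h1 h2 => ?_, fun m n hmn => by simp [ha' m n hmn]⟩
  simpa only [mul_assoc] using (ha x h1 h2).mul_left c

theorem IsGraded.add {p : ℕ} {d : ℤ} {f g : Bidisk → ℂ} (hf : IsGraded p d f)
    (hg : IsGraded p d g) : IsGraded p d fun x => f x + g x := by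
  obtain ⟨a, ha, ha'⟩ := hf
  obtain ⟨b, hb, hb'⟩ := hg
  refine ⟨fun m n => a m n + b m n, fun x h1 h2 => ?_, fun m n hmn => by
    simp [ha' m n hmn, hb' m n hmn]⟩
  simpa only [add_mul] using (ha x h1 h2).add (hb x h1 h2)

theorem isGraded_zero (p : ℕ) (d : ℤ) : IsGraded p d fun _ => 0 :=
  ⟨fun _ _ => 0, fun x _ _ => by simp, fun _ _ _ => rfl⟩

theorem isGraded_monomial {p : ℕ} {d : ℤ} (m n : ℕ) (h : Int.ModEq (p : ℤ) (m + n) d) :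
    IsGraded p d fun x => (x : ℂ × ℂ).1 ^ m * (x : ℂ × ℂ).2 ^ n := by
  refine ⟨_, by simpa using HasCoeffsAt.monomial 1 m n, fun m' n' h' => if_neg ?_⟩
  rintro ⟨rfl, rfl⟩
  exact h' h

/-- The coordinate function `z` on the bidisk. -/
def coordFst : C(Bidisk, ℂ) := ⟨fun x => (x : ℂ × ℂ).1, by fun_prop⟩

/-- The coordinate function `w` on the bidisk. -/
def coordSnd : C(Bidisk, ℂ) := ⟨fun x => (x : ℂ × ℂ).2, by fun_prop⟩

theorem isGraded_coordFst (p : ℕ) : IsGraded p 1 coordFst := by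
  change IsGraded p 1 fun x : Bidisk => (x : ℂ × ℂ).1
  simpa using isGraded_monomial (p := p) (d := 1) 1 0 (by simp)

theorem isGraded_coordSnd (p : ℕ) : IsGraded p 1 coordSnd := by
  change IsGraded p 1 fun x : Bidisk => (x : ℂ × ℂ).2
  simpa using isGraded_monomial (p := p) (d := 1) 0 1 (by simp)

/-- The involution exchanging the coordinates of the bidisk. -/
def Bidisk.swap : C(Bidisk, Bidisk) :=
  ⟨fun x => ⟨((x : ℂ × ℂ).2, (x : ℂ × ℂ).1), x.2.2, x.2.1⟩, by fun_prop⟩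

theorem HasCoeffsAt.comp_swap {f : Bidisk → ℂ} {a : ℕ → ℕ → ℂ} (h : HasCoeffsAt f a) :
    HasCoeffsAt (fun x => f (Bidisk.swap x)) fun m n => a n m := by
  intro x h1 h2
  have H := h (Bidisk.swap x) h2 h1
  rw [← (Equiv.prodComm ℕ ℕ).hasSum_iff] at H
  refine H.congr_fun fun mn => ?_
  simp only [Function.comp_apply, Equiv.prodComm_apply, Prod.fst_swap, Prod.snd_swap,
    Bidisk.swap, ContinuousMap.coe_mk]
  ring

theorem exists_mul_self_eq_coordFst_mul {p : ℕ} {d : ℤ} {q : C(Bidisk, ℂ)} {a : ℕ → ℕ → ℂ}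
    (h : HasCoeffsAt q a)
    (hd : ∀ m n : ℕ, ¬ Int.ModEq (p : ℤ) ((m : ℤ) + (n : ℤ)) d → a m n = 0)
    (h0 : ∀ n, a 0 n = 0) :
    ∃ g : C(Bidisk, ℂ), q * q = coordFst * g ∧ IsGraded p (d + d - 1) g := by
  obtain ⟨g, hg, hg'⟩ := h.exists_mul_self_eq h0
  refine ⟨g, ContinuousMap.ext hg, _, hg', fun m n hmn => Finset.sum_eq_zero fun x hx => ?_⟩
  rw [Finset.HasAntidiagonal.mem_antidiagonal] at hx
  have h1 : x.1.1 + x.2.1 = m + 1 := congrArg Prod.fst hx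
  have h2 : x.1.2 + x.2.2 = n := congrArg Prod.snd hx
  by_contra hne
  obtain ⟨h3, h4⟩ := mul_ne_zero_iff.mp hne
  have h5 := not_not.mp (mt (hd _ _) h3)
  have h6 := not_not.mp (mt (hd _ _) h4)
  refine hmn ?_
  have h7 := (h5.add h6).sub_right 1
  convert h7 using 1
  omega

theorem exists_mul_self_eq_coordSnd_mul {p : ℕ} {d : ℤ} {q : C(Bidisk, ℂ)} {a : ℕ → ℕ → ℂ}
    (h : HasCoeffsAt q a)
    (hd : ∀ m n : ℕ, ¬ Int.ModEq (p : ℤ) ((m : ℤ) + (n : ℤ)) d → a m n = 0)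
    (h0 : ∀ m, a m 0 = 0) :
    ∃ g : C(Bidisk, ℂ), q * q = coordSnd * g ∧ IsGraded p (d + d - 1) g := by
  obtain ⟨g, hg, b, hb, hb'⟩ := exists_mul_self_eq_coordFst_mul (q := q.comp Bidisk.swap)
    (p := p) (d := d) h.comp_swap (fun m n hmn => hd n m (by rwa [add_comm])) h0
  refine ⟨g.comp Bidisk.swap, ContinuousMap.ext fun x => ?_, _, hb.comp_swap,
    fun m n hmn => hb' n m (by rwa [add_comm])⟩
  exact DFunLike.congr_fun hg (Bidisk.swap x)

/-- A graded function of nonzero degree splits as `q + r` with `z ∣ q ^ 2` and `w ∣ r ^ 2`. -/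
theorem IsGraded.exists_split {p : ℕ} {d : ℤ} {f : C(Bidisk, ℂ)} (hf : IsGraded p d f)
    (hd : ¬ Int.ModEq (p : ℤ) 0 d) : ∃ q r g h : C(Bidisk, ℂ), f = q + r ∧
      IsGraded p d q ∧ IsGraded p d r ∧ q * q = coordFst * g ∧ r * r = coordSnd * h ∧
      IsGraded p (d + d - 1) g ∧ IsGraded p (d + d - 1) h := by
  obtain ⟨a, ha, ha'⟩ := hf
  let π : C(Bidisk, Bidisk) := ⟨fun x => ⟨(0, (x : ℂ × ℂ).2), by simp, x.2.2⟩, by fun_prop⟩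
  set r : C(Bidisk, ℂ) := f.comp π with hr
  set b : ℕ → ℕ → ℂ := fun m n => if m = 0 then a 0 n else 0 with hb
  have hrb : HasCoeffsAt r b := by
    intro x h1 h2
    refine (ha (π x) (by simp [π]) h2).congr_fun ?_
    rintro ⟨_ | m, n⟩ <;> simp [hb, π]
  have hb' : ∀ m n : ℕ, ¬ Int.ModEq (p : ℤ) ((m : ℤ) + (n : ℤ)) d → b m n = 0 := by
    rintro (_ | m) n hmn
    · simpa [hb] using ha' 0 n hmn
    · simp [hb]
  have hq : HasCoeffsAt (f - r : C(Bidisk, ℂ)) fun m n => a m n - b m n := ha.sub hrb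
  have hq' : ∀ m n : ℕ, ¬ Int.ModEq (p : ℤ) ((m : ℤ) + (n : ℤ)) d → a m n - b m n = 0 :=
    fun m n hmn => by rw [ha' m n hmn, hb' m n hmn, sub_zero]
  obtain ⟨g, hg, hgd⟩ := exists_mul_self_eq_coordFst_mul hq hq' (fun n => by simp [hb])
  obtain ⟨h, hh, hhd⟩ := exists_mul_self_eq_coordSnd_mul hrb hb' (fun m => by
    rcases m with _ | m
    · simpa [hb] using ha' 0 0 (by simpa using hd)
    · simp [hb])
  exact ⟨f - r, r, g, h, by simp, ⟨_, hq, hq'⟩, ⟨_, hrb, hb'⟩, hg, hh, hgd, hhd⟩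

theorem Fin.intCast_val_sub_modEq {p : ℕ} (a b : Fin p) :
    Int.ModEq (p : ℤ) (((a - b : Fin p) : ℕ) : ℤ) ((a : ℕ) - (b : ℕ) : ℤ) := by
  rw [Fin.intCast_val_sub_eq_sub_add_ite]
  split_ifs
  · simp [Int.ModEq]
  · simp [Int.ModEq]

theorem Fin.intCast_val_add_modEq {p : ℕ} (a b : Fin p) :
    Int.ModEq (p : ℤ) (((a + b : Fin p) : ℕ) : ℤ) ((a : ℕ) + (b : ℕ) : ℤ) := by
  rw [Fin.val_add]
  push_cast
  exact Int.mod_modEq _ _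

theorem Fin.intCast_val_one_modEq {p : ℕ} [NeZero p] :
    Int.ModEq (p : ℤ) (((1 : Fin p) : ℕ) : ℤ) 1 := by
  rw [Fin.val_one']
  push_cast
  exact Int.mod_modEq _ _

theorem memBk2_iff {p : ℕ} {F : C(Bidisk, Matrix (Fin p) (Fin p) ℂ)} :
    memBk2 p F ↔ ∀ i j : Fin p, IsGraded p ((i : ℤ) - (j : ℤ)) fun x => F x i j := Iff.rfl

theorem memBk2_add {p : ℕ} {F G : C(Bidisk, Matrix (Fin p) (Fin p) ℂ)}
    (hF : memBk2 p F) (hG : memBk2 p G) : memBk2 p (F + G) :=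
  fun i j => IsGraded.add (hF i j) (hG i j)

theorem memBk2_zero (p : ℕ) : memBk2 p 0 := fun _ _ => isGraded_zero _ _

section ShiftMatrix

variable {p : ℕ}

/-- The matrix function with entry `f` at all positions `(a, b)` with `a - b = d`. -/
def shiftMatrix (f : C(Bidisk, ℂ)) (d : Fin p) : C(Bidisk, Matrix (Fin p) (Fin p) ℂ) :=
  ⟨fun x => Matrix.of fun a b => if a - b = d then f x else 0, by
    refine continuous_matrix fun a b => ?_
    simp only [Matrix.of_apply]
    split_ifs <;> fun_prop⟩

theorem shiftMatrix_apply (f : C(Bidisk, ℂ)) (d : Fin p) (x : Bidisk) (a b : Fin p) :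
    shiftMatrix f d x a b = if a - b = d then f x else 0 := rfl

/-- Cyclic translation of the matrix indices. -/
def shiftIndices (d : Fin p) (F : C(Bidisk, Matrix (Fin p) (Fin p) ℂ)) :
    C(Bidisk, Matrix (Fin p) (Fin p) ℂ) :=
  ⟨fun x => (F x).submatrix (· - d) (· - d), F.continuous.matrix_submatrix _ _⟩

/-- The constant diagonal idempotents. -/
def diagIdem (i : Fin p) : C(Bidisk, Matrix (Fin p) (Fin p) ℂ) :=
  ContinuousMap.const _ (Matrix.diagonal (Pi.single i 1))

theorem memBk2_shiftMatrix {f : C(Bidisk, ℂ)} {d : Fin p} (hf : IsGraded p (d : ℕ) f) :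
    memBk2 p (shiftMatrix f d) := by
  refine memBk2_iff.2 fun a b => ?_
  simp only [shiftMatrix_apply]
  split_ifs with h
  · subst h
    exact hf.congr (Fin.intCast_val_sub_modEq a b)
  · exact isGraded_zero _ _

theorem memBk2_shiftIndices [NeZero p] {F : C(Bidisk, Matrix (Fin p) (Fin p) ℂ)} (hF : memBk2 p F)
    (d : Fin p) : memBk2 p (shiftIndices d F) := by
  refine memBk2_iff.2 fun a b => (memBk2_iff.1 hF (a - d) (b - d)).congr ?_
  simpa using (Fin.intCast_val_sub_modEq a d).sub (Fin.intCast_val_sub_modEq b d)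

theorem memBk2_one : memBk2 p 1 := by
  refine memBk2_iff.2 fun a b => ?_
  by_cases h : a = b
  · subst h
    simpa using isGraded_monomial (p := p) (d := 0) 0 0 (by simp)
  · simpa [h] using isGraded_zero p _

theorem diagIdem_mul_apply (i : Fin p) (F : C(Bidisk, Matrix (Fin p) (Fin p) ℂ)) (x : Bidisk)
    (a b : Fin p) : (diagIdem i * F) x a b = (Pi.single i 1 : Fin p → ℂ) a * F x a b := by
  simp [diagIdem]

theorem mul_diagIdem_apply (i : Fin p) (F : C(Bidisk, Matrix (Fin p) (Fin p) ℂ)) (x : Bidisk)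
    (a b : Fin p) : (F * diagIdem i) x a b = (Pi.single i 1 : Fin p → ℂ) b * F x a b := by
  simp [diagIdem, mul_comm]

theorem memBk2_diagIdem_mul {F : C(Bidisk, Matrix (Fin p) (Fin p) ℂ)} (hF : memBk2 p F)
    (i : Fin p) : memBk2 p (diagIdem i * F) := by
  refine memBk2_iff.2 fun a b => ?_
  simp only [diagIdem_mul_apply]
  exact IsGraded.const_mul (hF a b) _

theorem memBk2_mul_diagIdem {F : C(Bidisk, Matrix (Fin p) (Fin p) ℂ)} (hF : memBk2 p F)
    (i : Fin p) : memBk2 p (F * diagIdem i) := by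
  refine memBk2_iff.2 fun a b => ?_
  simp only [mul_diagIdem_apply]
  exact IsGraded.const_mul (hF a b) _

theorem memBk2_diagIdem (i : Fin p) : memBk2 p (diagIdem i) := by
  simpa using memBk2_diagIdem_mul memBk2_one i

theorem shiftMatrix_mul [NeZero p] (f g : C(Bidisk, ℂ)) (d e : Fin p) :
    shiftMatrix f d * shiftMatrix g e = shiftMatrix (f * g) (d + e) := by
  ext x a b
  simp only [ContinuousMap.mul_apply, Matrix.mul_apply, shiftMatrix_apply]
  rw [Finset.sum_eq_single (a - d)]
  · simp only [sub_sub_cancel, if_true, mul_ite, mul_zero]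
    congr 1
    rw [sub_right_comm, sub_eq_iff_eq_add, add_comm]
  · intro c _ hc
    rw [if_neg, zero_mul]
    rintro rfl
    simp at hc
  · simp

theorem shiftMatrix_add (f g : C(Bidisk, ℂ)) (d : Fin p) :
    shiftMatrix (f + g) d = shiftMatrix f d + shiftMatrix g d := by
  ext x a b
  simp only [ContinuousMap.add_apply, Matrix.add_apply, shiftMatrix_apply]
  split_ifs <;> simp

theorem shiftMatrix_mul_eq [NeZero p] (f : C(Bidisk, ℂ)) (d : Fin p)
    (F : C(Bidisk, Matrix (Fin p) (Fin p) ℂ)) :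
    shiftMatrix f d * F = shiftIndices d F * shiftMatrix f d := by
  ext x a b
  simp only [ContinuousMap.mul_apply, Matrix.mul_apply, shiftMatrix_apply]
  rw [Finset.sum_eq_single (a - d), Finset.sum_eq_single (b + d)]
  · simp [shiftIndices, mul_comm]
  · intro c _ hc
    rw [if_neg, mul_zero]
    rintro rfl
    simp at hc
  · simp
  · intro c _ hc
    rw [if_neg, zero_mul]
    rintro rfl
    simp at hc
  · simp

theorem shiftIndices_diagIdem [NeZero p] (d i : Fin p) :
    shiftIndices d (diagIdem i) = diagIdem (i + d) := by
  ext x a b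
  simp [shiftIndices, diagIdem, Matrix.diagonal_apply, Pi.single_apply, sub_eq_iff_eq_add]

theorem diagIdem_mul_diagIdem (i j : Fin p) :
    diagIdem i * diagIdem j = if i = j then diagIdem i else 0 := by
  ext x a b
  rw [diagIdem_mul_apply]
  split_ifs with h
  · subst h
    by_cases ha : a = i
    · simp [ha]
    · simp [ha, diagIdem, Matrix.diagonal_apply]
  · by_cases ha : a = i
    · subst ha
      simp [diagIdem, Matrix.diagonal_apply, h]
    · simp [ha]

theorem sum_diagIdem : ∑ i : Fin p, diagIdem i = 1 := by
  ext x a b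
  simp [diagIdem, Matrix.sum_apply, Matrix.diagonal_apply, Matrix.one_apply, Pi.single_apply]

theorem diagIdem_corner_comm (i : Fin p) (F G : C(Bidisk, Matrix (Fin p) (Fin p) ℂ)) :
    (diagIdem i * F * diagIdem i) * (diagIdem i * G * diagIdem i) =
      (diagIdem i * G * diagIdem i) * (diagIdem i * F * diagIdem i) := by
  ext x a b
  simp only [ContinuousMap.mul_apply (diagIdem i * _ * _), Matrix.mul_apply, mul_diagIdem_apply,
    diagIdem_mul_apply]
  rw [Finset.sum_eq_single i, Finset.sum_eq_single i]
  · by_cases ha : a = i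
    · by_cases hb : b = i
      · subst ha hb
        simp [mul_comm]
      · simp [hb]
    · simp [ha]
  all_goals simp +contextual

theorem diagIdem_mul_mul_diagIdem (i j : Fin p) (F : C(Bidisk, Matrix (Fin p) (Fin p) ℂ))
    (f : C(Bidisk, ℂ)) (hf : ∀ x, f x = F x i j) :
    diagIdem i * F * diagIdem j = diagIdem i * shiftMatrix f (i - j) * diagIdem j := by
  ext x a b
  simp only [mul_diagIdem_apply, diagIdem_mul_apply, shiftMatrix_apply]
  by_cases ha : a = i
  · by_cases hb : b = j
    · subst ha hb
      simp [hf]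
    · simp [hb]
  · simp [ha]

end ShiftMatrix

section Corner

variable {ι : Type*} [Fintype ι] [DecidableEq ι]

/-- A nonzero idempotent matrix with commutative corner has trace `±1`. -/
theorem Matrix.trace_sq_eq_one_of_corner_comm {e : Matrix ι ι ℂ} (he : e * e = e) (h0 : e ≠ 0)
    (h : ∀ A B : Matrix ι ι ℂ, (e * A * e) * (e * B * e) = (e * B * e) * (e * A * e)) :
    e.trace ^ 2 = 1 := by
  have hsq : ∀ a b, ∑ c, e a c * e c b = e a b := fun a b => by
    rw [← Matrix.mul_apply, he]
  have hent : ∀ i s t u v j, e i s * e t u * e v j = e i u * e v s * e t j := by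
    intro i s t u v j
    have H := h (Matrix.single s t 1) (Matrix.single u v 1)
    have key : ∀ s t u v, (e * Matrix.single s t 1 * e) * (e * Matrix.single u v 1 * e) =
        e * Matrix.single s t 1 * e * Matrix.single u v 1 * e := by
      intro s t u v
      simp only [Matrix.mul_assoc]
      rw [← Matrix.mul_assoc e e, he]
    rw [key, key] at H
    have H' := congrFun (congrFun H i) j
    simpa [Matrix.mul_apply, Matrix.single_apply, ite_and, Finset.sum_mul, Finset.mul_sum] using H'
  have h1 : ∀ t u v j, e.trace * e t u * e v j = e v u * e t j := by
    intro t u v j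
    rw [Matrix.trace, Finset.sum_mul, Finset.sum_mul]
    simp only [Matrix.diag_apply, hent, ← Finset.sum_mul]
    congr 1
    rw [← hsq v u]
    exact Finset.sum_congr rfl fun _ _ => mul_comm _ _
  have h2 : ∀ v j, e.trace ^ 2 * e v j = e v j := by
    intro v j
    have : ∑ t, e.trace * e t t * e v j = ∑ t, e v t * e t j :=
      Finset.sum_congr rfl fun t _ => h1 t t v j
    rw [hsq, ← Finset.sum_mul, ← Finset.mul_sum] at this
    rwa [pow_two]
  obtain ⟨v, j, hvj⟩ : ∃ v j, e v j ≠ 0 := by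
    by_contra! hne
    exact h0 (Matrix.ext hne)
  exact mul_right_cancel₀ hvj ((h2 v j).trans (one_mul _).symm)

/-- A matrix `N` with `N A ∈ M N` for all `A` is zero or invertible. -/
theorem Matrix.eq_zero_or_isUnit_of_normal {N : Matrix ι ι ℂ}
    (h : ∀ A : Matrix ι ι ℂ, ∃ A' : Matrix ι ι ℂ, N * A = A' * N) : N = 0 ∨ IsUnit N := by
  by_cases hN : IsUnit N
  · exact Or.inr hN
  left
  rw [Matrix.isUnit_iff_isUnit_det, isUnit_iff_ne_zero, not_not,
    ← Matrix.exists_mulVec_eq_zero_iff] at hN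
  obtain ⟨v, hv0, hv⟩ := hN
  obtain ⟨j, hj⟩ := Function.ne_iff.mp hv0
  ext a b
  obtain ⟨A', hA'⟩ := h (Matrix.single b j 1)
  have h1 : (N * Matrix.single b j 1).mulVec v = 0 := by
    rw [hA', ← Matrix.mulVec_mulVec, hv, Matrix.mulVec_zero]
  have h2 := congrFun h1 a
  rw [← Matrix.mulVec_mulVec, Matrix.single_mulVec] at h2
  have h3 : N a b * v j = 0 := by
    simpa [Matrix.mulVec, dotProduct, Function.update_apply] using h2
  exact (mul_eq_zero.mp h3).resolve_right hj

theorem Matrix.not_forall_mul_comm [Nontrivial ι] :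
    ¬ ∀ A B : Matrix ι ι ℂ, A * B = B * A := by
  intro h
  obtain ⟨i, j, hij⟩ := exists_pair_ne ι
  have := congrFun (congrFun (h (Matrix.single i i 1) (Matrix.single i j 1)) i) j
  simp [Matrix.mul_apply, Matrix.single_apply, hij] at this

end Corner

/-- `π` restricts to a surjective unital ring homomorphism from the algebra cut out by `memBk2`
onto a full matrix algebra. -/
structure IsMatrixRep (p : ℕ) {ι : Type*} [Fintype ι] [DecidableEq ι]
    (π : C(Bidisk, Matrix (Fin p) (Fin p) ℂ) → Matrix ι ι ℂ) : Prop where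
  surj : ∀ A, ∃ F, memBk2 p F ∧ π F = A
  map_add : ∀ F G, memBk2 p F → memBk2 p G → π (F + G) = π F + π G
  map_mul : ∀ F G, memBk2 p F → memBk2 p G → π (F * G) = π F * π G
  map_one : π 1 = 1

namespace IsMatrixRep

variable {p : ℕ} {ι : Type*} [Fintype ι] [DecidableEq ι]
  {π : C(Bidisk, Matrix (Fin p) (Fin p) ℂ) → Matrix ι ι ℂ}

theorem map_zero (h : IsMatrixRep p π) : π 0 = 0 := by
  simpa using h.map_add 0 0 (memBk2_zero p) (memBk2_zero p)

theorem map_sum (h : IsMatrixRep p π) {κ : Type*} (s : Finset κ)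
    (F : κ → C(Bidisk, Matrix (Fin p) (Fin p) ℂ)) (hF : ∀ i, memBk2 p (F i)) :
    memBk2 p (∑ i ∈ s, F i) ∧ π (∑ i ∈ s, F i) = ∑ i ∈ s, π (F i) := by
  classical
  induction s using Finset.induction_on with
  | empty => simpa using ⟨memBk2_zero p, h.map_zero⟩
  | insert i s hi ih =>
    rw [Finset.sum_insert hi, Finset.sum_insert hi, h.map_add _ _ (hF i) ih.1, ih.2]
    exact ⟨memBk2_add (hF i) ih.1, rfl⟩

theorem sum_diagIdem (h : IsMatrixRep p π) : ∑ i, π (diagIdem i) = 1 := by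
  rw [← (h.map_sum Finset.univ _ memBk2_diagIdem).2, _root_.sum_diagIdem, h.map_one]

theorem diagIdem_mul (h : IsMatrixRep p π) (i j : Fin p) :
    π (diagIdem i) * π (diagIdem j) = if i = j then π (diagIdem i) else 0 := by
  rw [← h.map_mul _ _ (memBk2_diagIdem i) (memBk2_diagIdem j), diagIdem_mul_diagIdem]
  split_ifs
  · rfl
  · exact h.map_zero

theorem map_corner (h : IsMatrixRep p π) (i j : Fin p)
    {F : C(Bidisk, Matrix (Fin p) (Fin p) ℂ)} (hF : memBk2 p F) :
    π (diagIdem i * F * diagIdem j) = π (diagIdem i) * π F * π (diagIdem j) := by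
  rw [h.map_mul _ _ (memBk2_diagIdem_mul hF i) (memBk2_diagIdem j),
    h.map_mul _ _ (memBk2_diagIdem i) hF]

theorem corner_comm (h : IsMatrixRep p π) (i : Fin p) (A B : Matrix ι ι ℂ) :
    (π (diagIdem i) * A * π (diagIdem i)) * (π (diagIdem i) * B * π (diagIdem i)) =
      (π (diagIdem i) * B * π (diagIdem i)) * (π (diagIdem i) * A * π (diagIdem i)) := by
  obtain ⟨F, hF, rfl⟩ := h.surj A
  obtain ⟨G, hG, rfl⟩ := h.surj B
  have hF' := memBk2_mul_diagIdem (memBk2_diagIdem_mul hF i) i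
  have hG' := memBk2_mul_diagIdem (memBk2_diagIdem_mul hG i) i
  rw [← h.map_corner i i hF, ← h.map_corner i i hG, ← h.map_mul _ _ hF' hG',
    ← h.map_mul _ _ hG' hF', diagIdem_corner_comm]

variable [NeZero p]

theorem shiftMatrix_eq_zero_or_isUnit (h : IsMatrixRep p π) {f : C(Bidisk, ℂ)} {d : Fin p}
    (hf : IsGraded p (d : ℕ) f) : π (shiftMatrix f d) = 0 ∨ IsUnit (π (shiftMatrix f d)) := by
  refine Matrix.eq_zero_or_isUnit_of_normal fun A => ?_
  obtain ⟨F, hF, rfl⟩ := h.surj A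
  refine ⟨π (shiftIndices d F), ?_⟩
  rw [← h.map_mul _ _ (memBk2_shiftMatrix hf) hF,
    ← h.map_mul _ _ (memBk2_shiftIndices hF d) (memBk2_shiftMatrix hf), shiftMatrix_mul_eq]

theorem card_eq_of_isUnit [Nonempty ι] (h : IsMatrixRep p π) {f : C(Bidisk, ℂ)}
    (hf : IsGraded p ((1 : Fin p) : ℕ) f) (hu : IsUnit (π (shiftMatrix f 1))) :
    Fintype.card ι = p := by
  obtain ⟨u, hu⟩ := hu
  have hconj : ∀ i : Fin p, π (diagIdem (i + 1)) =
      u * π (diagIdem i) * ((u⁻¹ : (Matrix ι ι ℂ)ˣ) : Matrix ι ι ℂ) := by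
    intro i
    rw [Units.eq_mul_inv_iff_mul_eq, hu, ← h.map_mul _ _ (memBk2_diagIdem _) (memBk2_shiftMatrix hf),
      ← h.map_mul _ _ (memBk2_shiftMatrix hf) (memBk2_diagIdem _), shiftMatrix_mul_eq,
      shiftIndices_diagIdem]
  have hind : ∀ (n : ℕ) (hn : n < p),
      (π (diagIdem (⟨n, hn⟩ : Fin p))).trace = (π (diagIdem (0 : Fin p))).trace ∧
      (π (diagIdem (0 : Fin p)) = 0 → π (diagIdem (⟨n, hn⟩ : Fin p)) = 0) := by
    intro n
    induction n with
    | zero => exact fun _ => ⟨rfl, id⟩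
    | succ n ih =>
      intro hn
      have ih := ih (by omega)
      have hsucc : (⟨n + 1, hn⟩ : Fin p) = ⟨n, by omega⟩ + 1 :=
        Fin.ext (by simp [Fin.val_add, Nat.mod_eq_of_lt hn])
      rw [hsucc, hconj, Matrix.trace_units_conj]
      exact ⟨ih.1, fun h0 => by simp [ih.2 h0]⟩
  have hsum := h.sum_diagIdem
  have h0 : π (diagIdem (0 : Fin p)) ≠ 0 := by
    intro h0
    have : ∀ i : Fin p, π (diagIdem i) = 0 := fun i => (hind i i.2).2 h0
    simp [this] at hsum
  have htr : (p : ℂ) * (π (diagIdem (0 : Fin p))).trace = Fintype.card ι := by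
    have h1 := congrArg Matrix.trace hsum
    have h2 : ∀ i : Fin p, (π (diagIdem i)).trace = (π (diagIdem (0 : Fin p))).trace := fun i =>
      (hind i i.2).1
    simpa [Matrix.trace_sum, h2] using h1
  have hsq := Matrix.trace_sq_eq_one_of_corner_comm (by simpa using h.diagIdem_mul 0 0) h0
    (h.corner_comm 0)
  have : (p : ℂ) ^ 2 = (Fintype.card ι : ℂ) ^ 2 := by rw [← htr, mul_pow, hsq, mul_one]
  have h3 : p ^ 2 = Fintype.card ι ^ 2 := by exact_mod_cast this
  exact (Nat.pow_left_injective two_ne_zero h3).symm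

theorem corner_eq_zero [Nonempty ι] (h : IsMatrixRep p π)
    (hz : π (shiftMatrix coordFst 1) = 0) (hw : π (shiftMatrix coordSnd 1) = 0)
    {i j : Fin p} (hij : i ≠ j) (A : Matrix ι ι ℂ) :
    π (diagIdem i) * A * π (diagIdem j) = 0 := by
  obtain ⟨F, hF, rfl⟩ := h.surj A
  let f : C(Bidisk, ℂ) := ⟨fun x => F x i j, F.continuous.matrix_elem i j⟩
  set d : Fin p := i - j with hd
  have hf : IsGraded p (d : ℕ) f :=
    (memBk2_iff.1 hF i j).congr (Fin.intCast_val_sub_modEq i j).symm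
  have hd0 : ¬ Int.ModEq (p : ℤ) 0 (d : ℕ) := by
    intro hmod
    have : p ∣ (d : ℕ) := by exact_mod_cast (Int.modEq_zero_iff_dvd.mp hmod.symm)
    have h0 : (d : ℕ) = 0 := Nat.eq_zero_of_dvd_of_lt this d.2
    exact hij (sub_eq_zero.mp (Fin.ext h0 : d = 0))
  have hdeg : Int.ModEq (p : ℤ) ((d : ℕ) + (d : ℕ) - 1) ((d + d - 1 : Fin p) : ℕ) :=
    ((Fin.intCast_val_sub_modEq _ _).trans
      ((Fin.intCast_val_add_modEq d d).sub Fin.intCast_val_one_modEq)).symm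
  have hone : Int.ModEq (p : ℤ) 1 ((1 : Fin p) : ℕ) := Fin.intCast_val_one_modEq.symm
  have hnil : ∀ (c q g : C(Bidisk, ℂ)), IsGraded p 1 c → π (shiftMatrix c 1) = 0 →
      IsGraded p (d : ℕ) q → q * q = c * g → IsGraded p ((d : ℕ) + (d : ℕ) - 1) g →
      π (shiftMatrix q d) = 0 := by
    intro c q g hc hc0 hq hqq hg
    refine (h.shiftMatrix_eq_zero_or_isUnit hq).resolve_right fun hu => ?_
    have hsq : π (shiftMatrix q d) * π (shiftMatrix q d) = 0 := by
      rw [← h.map_mul _ _ (memBk2_shiftMatrix hq) (memBk2_shiftMatrix hq), shiftMatrix_mul, hqq,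
        show d + d = 1 + (d + d - 1) by abel, ← shiftMatrix_mul,
        h.map_mul _ _ (memBk2_shiftMatrix (hc.congr hone)) (memBk2_shiftMatrix (hg.congr hdeg)),
        hc0, zero_mul]
    exact (hu.mul hu).ne_zero hsq
  obtain ⟨q, r, g, g', hfqr, hq, hr, hqq, hrr, hg, hg'⟩ := hf.exists_split hd0
  have hfz : π (shiftMatrix f d) = 0 := by
    rw [hfqr, shiftMatrix_add, h.map_add _ _ (memBk2_shiftMatrix hq) (memBk2_shiftMatrix hr),
      hnil _ q g (isGraded_coordFst p) hz hq hqq hg,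
      hnil _ r g' (isGraded_coordSnd p) hw hr hrr hg', add_zero]
  rw [← h.map_corner i j hF, diagIdem_mul_mul_diagIdem i j F f fun _ => rfl, ← hd,
    h.map_corner i j (memBk2_shiftMatrix hf), hfz, mul_zero, zero_mul]

/-- The algebra cut out by `memBk2` maps onto no noncommutative matrix algebra other than `M_p`. -/
theorem card_eq [Nontrivial ι] (h : IsMatrixRep p π) : Fintype.card ι = p := by
  have hone : Int.ModEq (p : ℤ) 1 ((1 : Fin p) : ℕ) := Fin.intCast_val_one_modEq.symm
  have hz' := (isGraded_coordFst p).congr hone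
  have hw' := (isGraded_coordSnd p).congr hone
  rcases h.shiftMatrix_eq_zero_or_isUnit hz' with hz | hz
  swap
  · exact h.card_eq_of_isUnit hz' hz
  rcases h.shiftMatrix_eq_zero_or_isUnit hw' with hw | hw
  swap
  · exact h.card_eq_of_isUnit hw' hw
  refine absurd (fun A B => ?_) (Matrix.not_forall_mul_comm (ι := ι))
  have hleft : ∀ (i : Fin p) (A : Matrix ι ι ℂ),
      π (diagIdem i) * A = π (diagIdem i) * A * π (diagIdem i) := by
    intro i A
    conv_lhs => rw [← mul_one (π (diagIdem i) * A), ← h.sum_diagIdem, Finset.mul_sum]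
    exact Finset.sum_eq_single i (fun j _ hj => h.corner_eq_zero hz hw hj.symm A) (by simp)
  have hprod : ∀ (i : Fin p) (A B : Matrix ι ι ℂ), π (diagIdem i) * (A * B) =
      (π (diagIdem i) * A * π (diagIdem i)) * (π (diagIdem i) * B * π (diagIdem i)) := by
    intro i A B
    have hii : π (diagIdem i) * π (diagIdem i) = π (diagIdem i) := by
      simpa using h.diagIdem_mul i i
    rw [← hleft, ← hleft, ← mul_assoc, hleft i A, mul_assoc, mul_assoc, mul_assoc,
      ← mul_assoc (π (diagIdem i)) (π (diagIdem i)) B, hii]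
    simp only [← mul_assoc]
  rw [← one_mul (A * B), ← one_mul (B * A), ← h.sum_diagIdem, Finset.sum_mul, Finset.sum_mul]
  exact Finset.sum_congr rfl fun i _ => by rw [hprod, hprod, h.corner_comm]

end IsMatrixRep

section Tensor

variable {k l : ℕ}

/-- The matrix function with monomial entries `c_{(i,i'),(j,j')} z ^ m w ^ n`, where
`m` and `n` are the residues of `i - j` and `i' - j'`. -/
def monomialMatrix (c : Matrix (Fin k × Fin l) (Fin k × Fin l) ℂ) : TM k l :=
  ⟨fun x => Matrix.of fun a b => c a b * (x : ℂ × ℂ).1 ^ ((a.1 - b.1 : Fin k) : ℕ) *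
    (x : ℂ × ℂ).2 ^ ((a.2 - b.2 : Fin l) : ℕ), by
    refine continuous_matrix fun a b => ?_
    simp only [Matrix.of_apply]
    fun_prop⟩

theorem memT_monomialMatrix (c : Matrix (Fin k × Fin l) (Fin k × Fin l) ℂ) :
    memT k l (monomialMatrix c) := by
  intro i j i' j'
  refine ⟨_, HasCoeffsAt.monomial (c (i, i') (j, j')) _ _, fun m n hmn => if_neg ?_⟩
  rintro ⟨rfl, rfl⟩
  exact hmn ⟨Fin.intCast_val_sub_modEq i j, Fin.intCast_val_sub_modEq i' j'⟩

/-- The point `(1/2, 1/2)`. -/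
def ptHalf : Bidisk := ⟨(1 / 2, 1 / 2), by simp [Bidisk]; norm_num⟩

/-- The point `(0, 1/2)`. -/
def ptZeroHalf : Bidisk := ⟨(0, 1 / 2), by simp [Bidisk]; norm_num⟩

theorem memT.apply_ptZeroHalf {G : TM k l} (hG : memT k l G) {i j : Fin k} (hij : i ≠ j)
    (i' j' : Fin l) : G ptZeroHalf (i, i') (j, j') = 0 := by
  obtain ⟨a, ha, ha'⟩ := hG i j i' j'
  refine (ha ptZeroHalf (by simp [ptZeroHalf]) (by simp [ptZeroHalf]; norm_num)).unique ?_
  convert hasSum_zero with mn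
  rcases mn with ⟨_ | m, n⟩
  · rw [ha' 0 n, zero_mul, zero_mul]
    rintro ⟨h, -⟩
    refine hij (Fin.ext ?_)
    have h1 : Int.ModEq (k : ℤ) (j : ℕ) (i : ℕ) := by
      simpa using h.add_right (j : ℤ)
    have h2 : (j : ℕ) ≡ i [MOD k] := (Int.natCast_modEq_iff).mp h1
    exact (h2.eq_of_lt_of_lt j.2 i.2).symm
  · simp [ptZeroHalf]

end Tensor

/-- for `p ≥ 1` and `k, ℓ > 1`, there is no `ℂ`-algebra isomorphism between
`B_{p,2}` and `T_{k,ℓ}`. -/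
theorem stmt15 (p k l : ℕ) (hp : 1 ≤ p) (hk : 1 < k) (hl : 1 < l) :
    ¬ ∃ φ : C(Bidisk, Matrix (Fin p) (Fin p) ℂ) → TM k l,
      (∀ F, memBk2 p F → memT k l (φ F)) ∧
      (∀ G, memT k l G → ∃ F, memBk2 p F ∧ φ F = G) ∧
      (∀ F G, memBk2 p F → memBk2 p G → φ F = φ G → F = G) ∧
      (∀ F G, memBk2 p F → memBk2 p G → φ (F + G) = φ F + φ G) ∧
      (∀ (c : ℂ) (F), memBk2 p F → φ (c • F) = c • φ F) ∧
      (∀ F G, memBk2 p F → memBk2 p G → φ (F * G) = φ F * φ G) ∧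
      φ 1 = 1 := by

  rintro ⟨φ, hmem, hsurj, -, hadd, -, hmul, hone⟩
  have : NeZero p := ⟨by omega⟩
  have : NeZero k := ⟨by omega⟩
  have : Nontrivial (Fin l) := Fin.nontrivial_iff_two_le.mpr hl
  have hfull : IsMatrixRep p fun F => φ F ptHalf := by
    refine ⟨fun A => ?_, fun F G hF hG => ?_, fun F G hF hG => ?_, ?_⟩
    · obtain ⟨F, hF, hFA⟩ := hsurj _ (memT_monomialMatrix (k := k) (l := l)
        (Matrix.of fun a b => A a b * 2 ^ ((a.1 - b.1 : Fin k) : ℕ) * 2 ^ ((a.2 - b.2 : Fin l) : ℕ)))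
      refine ⟨F, hF, ?_⟩
      ext a b
      simp only [hFA, monomialMatrix, ptHalf, ContinuousMap.coe_mk, Matrix.of_apply, one_div,
        inv_pow]
      field_simp
    · simp only [hadd F G hF hG, ContinuousMap.add_apply]
    · simp only [hmul F G hF hG, ContinuousMap.mul_apply]
    · simp only [hone, ContinuousMap.one_apply]
  have hblock : IsMatrixRep p fun F =>
      (φ F ptZeroHalf).submatrix (fun i' : Fin l => ((0 : Fin k), i')) fun j' => (0, j') := by
    refine ⟨fun A => ?_, fun F G hF hG => ?_, fun F G hF hG => ?_, ?_⟩
    · obtain ⟨F, hF, hFA⟩ := hsurj _ (memT_monomialMatrix (k := k) (l := l)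
        (Matrix.of fun a b => A a.2 b.2 * 2 ^ ((a.2 - b.2 : Fin l) : ℕ)))
      refine ⟨F, hF, ?_⟩
      ext a b
      simp only [hFA, monomialMatrix, ptZeroHalf, ContinuousMap.coe_mk, Matrix.of_apply, one_div,
        inv_pow, Matrix.submatrix_apply, sub_self, Fin.val_zero, pow_zero, mul_one]
      field_simp
    · simp only [hadd F G hF hG, ContinuousMap.add_apply, Matrix.submatrix_add, Pi.add_apply]
    · ext a b
      simp only [hmul F G hF hG, ContinuousMap.mul_apply, Matrix.submatrix_apply, Matrix.mul_apply,
        Fintype.sum_prod_type]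
      refine Finset.sum_eq_single 0 (fun i _ hi => Finset.sum_eq_zero fun j _ => ?_) (by simp)
      rw [(hmem F hF).apply_ptZeroHalf hi.symm, zero_mul]
    · ext a b
      simp [hone, Matrix.one_apply]
  have h1 := hfull.card_eq
  have h2 := hblock.card_eq
  simp only [Fintype.card_prod, Fintype.card_fin] at h1 h2
  subst h2
  have : k = 1 := Nat.eq_of_mul_eq_mul_right (by omega) (h1.trans (one_mul l).symm)
  omega
end
end

section
/- Let X be a finite nonempty set and σ₁, σ₂ commuting permutations of X, inducing the ℤ²-action σ(m,n) = σ₁^m σ₂^n. Then σ is a perpendicular action if and only if both of the following hold: (i) for all x, y ∈ X, the intersection O_{σ₁}^x ∩ O_{σ₂}^y consists of exactly one point; (ii) all σ₁-orbits have the same cardinality, and all σ₂-orbits have the same cardinality. -/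
/-- The orbit `{σ^n x : n ∈ ℤ}` of `x` under the permutation `σ`. -/
def Orb {X : Type*} (σ : Equiv.Perm X) (x : X) : Set X := {y | ∃ n : ℤ, (σ ^ n) x = y}

/-- A permutation is transitive if it has a single orbit. -/
def IsTransitivePerm {Y : Type*} (τ : Equiv.Perm Y) : Prop :=
  ∀ y y' : Y, ∃ n : ℤ, (τ ^ n) y = y'

/-- The `ℤ²`-action generated by the commuting permutations `σ₁, σ₂` is perpendicular:
it is conjugate, via a bijection `h : X ≃ X₁ × X₂`, to the product of transitive
permutations `τ₁`, `τ₂` of finite sets `X₁`, `X₂`. -/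
def Perpendicular {X : Type*} (σ₁ σ₂ : Equiv.Perm X) : Prop :=
  ∃ (X₁ X₂ : Type) (_ : Fintype X₁) (_ : Fintype X₂)
    (τ₁ : Equiv.Perm X₁) (τ₂ : Equiv.Perm X₂) (h : X ≃ X₁ × X₂),
    IsTransitivePerm τ₁ ∧ IsTransitivePerm τ₂ ∧
    (∀ x : X, h (σ₁ x) = (τ₁ (h x).1, (h x).2)) ∧
    (∀ x : X, h (σ₂ x) = ((h x).1, τ₂ (h x).2))

theorem mem_orb_iff_sameCycle {X : Type*} {σ : Equiv.Perm X} {x y : X} :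
    y ∈ Orb σ x ↔ σ.SameCycle x y :=
  Iff.rfl

theorem Function.Semiconj.perm_zpow {X Y : Type*} {f : X → Y} {σ : Equiv.Perm X}
    {τ : Equiv.Perm Y} (hf : Function.Semiconj f σ τ) (n : ℤ) :
    Function.Semiconj f (σ ^ n : Equiv.Perm X) (τ ^ n : Equiv.Perm Y) := by
  have hpow (k : ℕ) :
      Function.Semiconj f (σ ^ k : Equiv.Perm X) (τ ^ k : Equiv.Perm Y) := by
    simpa only [Equiv.Perm.coe_pow] using hf.iterate_right k
  cases n with
  | ofNat k => simpa using hpow k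
  | negSucc k =>
    rw [zpow_negSucc, zpow_negSucc]
    intro x
    rw [Equiv.Perm.eq_inv_iff_eq, ← (hpow (k + 1)).eq]
    simp

theorem IsTransitivePerm.permCongr {Y Z : Type*} {τ : Equiv.Perm Y} (hτ : IsTransitivePerm τ)
    (e : Y ≃ Z) : IsTransitivePerm (e.permCongr τ) := by
  intro z z'
  obtain ⟨n, hn⟩ := hτ (e.symm z) (e.symm z')
  have hsemi : Function.Semiconj e τ (e.permCongr τ) := fun y => by simp
  refine ⟨n, ?_⟩
  simpa [hn] using ((hsemi.perm_zpow n).eq (e.symm z)).symm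

/-- The restriction of a permutation to one of its orbits. -/
def orbPerm {X : Type*} (σ : Equiv.Perm X) (x : X) : Equiv.Perm (Orb σ x) :=
  σ.subtypePerm fun _ => Equiv.Perm.sameCycle_apply_right

theorem isTransitivePerm_orbPerm {X : Type*} (σ : Equiv.Perm X) (x : X) :
    IsTransitivePerm (orbPerm σ x) := by
  rintro ⟨y, hy⟩ ⟨z, hz⟩
  obtain ⟨n, hn⟩ := (mem_orb_iff_sameCycle.1 hy).symm.trans (mem_orb_iff_sameCycle.1 hz)
  have hsemi : Function.Semiconj Subtype.val (orbPerm σ x) σ := fun _ => rfl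
  exact ⟨n, Subtype.ext (((hsemi.perm_zpow n).eq _).trans hn)⟩

theorem perpendicular_of_equiv_prod {X Y Z : Type*} [Finite Y] [Finite Z]
    {σ₁ σ₂ : Equiv.Perm X} {τ₁ : Equiv.Perm Y} {τ₂ : Equiv.Perm Z} (h : X ≃ Y × Z)
    (hτ₁ : IsTransitivePerm τ₁) (hτ₂ : IsTransitivePerm τ₂)
    (h₁ : ∀ x, h (σ₁ x) = (τ₁ (h x).1, (h x).2))
    (h₂ : ∀ x, h (σ₂ x) = ((h x).1, τ₂ (h x).2)) : Perpendicular σ₁ σ₂ := by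
  let e := Finite.equivFin Y
  let e' := Finite.equivFin Z
  exact ⟨_, _, inferInstance, inferInstance, e.permCongr τ₁, e'.permCongr τ₂,
    h.trans (e.prodCongr e'), hτ₁.permCongr e, hτ₂.permCongr e',
    fun x => by simp [h₁], fun x => by simp [h₂]⟩

section Product

variable {X Y Z : Type*} {σ₁ : Equiv.Perm X} {τ₁ : Equiv.Perm Y}

theorem mem_orb_iff_snd_eq (h : X ≃ Y × Z) (hτ₁ : IsTransitivePerm τ₁)
    (h₁ : ∀ x, h (σ₁ x) = (τ₁ (h x).1, (h x).2)) (x z : X) :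
    z ∈ Orb σ₁ x ↔ (h z).2 = (h x).2 := by
  have hfst : Function.Semiconj (fun x => (h x).1) σ₁ τ₁ := fun x => by simp [h₁]
  have hsnd : Function.Semiconj (fun x => (h x).2) σ₁ (1 : Equiv.Perm Z) :=
    fun x => by simp [h₁]
  have hsnd_zpow (n : ℤ) (x : X) : (h ((σ₁ ^ n) x)).2 = (h x).2 := by
    simpa using (hsnd.perm_zpow n).eq x
  constructor
  · rintro ⟨n, rfl⟩
    exact hsnd_zpow n x
  · intro hz
    obtain ⟨n, hn⟩ := hτ₁ (h x).1 (h z).1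
    exact ⟨n, h.injective (Prod.ext (((hfst.perm_zpow n).eq x).trans hn)
      ((hsnd_zpow n x).trans hz.symm))⟩

theorem ncard_orb_eq_card (h : X ≃ Y × Z) (hτ₁ : IsTransitivePerm τ₁)
    (h₁ : ∀ x, h (σ₁ x) = (τ₁ (h x).1, (h x).2)) (x : X) :
    (Orb σ₁ x).ncard = Nat.card Y := by
  have horb : Orb σ₁ x = Set.range fun y => h.symm (y, (h x).2) := by
    ext z
    rw [mem_orb_iff_snd_eq h hτ₁ h₁]
    constructor
    · intro hz
      exact ⟨(h z).1, by simp [← hz]⟩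
    · rintro ⟨y, rfl⟩
      simp
  rw [horb, ← Nat.card_coe_set_eq, Nat.card_range_of_injective]
  intro y y' hy
  simpa using hy

end Product

theorem perpendicular_of_existsUnique_mem_orb {X : Type*} [Finite X] [Nonempty X]
    {σ₁ σ₂ : Equiv.Perm X} (hcomm : Commute σ₁ σ₂)
    (hinter : ∀ x y : X, ∃! z : X, z ∈ Orb σ₁ x ∧ z ∈ Orb σ₂ y) : Perpendicular σ₁ σ₂ := by
  obtain ⟨o⟩ := ‹Nonempty X›
  choose p hp huniq using hinter
  simp only [mem_orb_iff_sameCycle] at hp huniq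
  have hsemi₁ : Function.Semiconj σ₁ σ₂ σ₂ := fun x => DFunLike.congr_fun hcomm.eq x
  have hsemi₂ : Function.Semiconj σ₂ σ₁ σ₁ := fun x => DFunLike.congr_fun hcomm.symm.eq x
  have hcycle₁ {x y : X} : σ₂.SameCycle x y → σ₂.SameCycle (σ₁ x) (σ₁ y) := by
    rintro ⟨n, rfl⟩
    exact ⟨n, ((hsemi₁.perm_zpow n).eq x).symm⟩
  have hcycle₂ {x y : X} : σ₁.SameCycle x y → σ₁.SameCycle (σ₂ x) (σ₂ y) := by
    rintro ⟨n, rfl⟩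
    exact ⟨n, ((hsemi₂.perm_zpow n).eq x).symm⟩
  let h : X ≃ Orb σ₁ o × Orb σ₂ o :=
    { toFun := fun x => (⟨p o x, (hp o x).1⟩, ⟨p x o, (hp x o).2⟩)
      invFun := fun q => p q.2 q.1
      left_inv := fun x => (huniq _ _ _ ⟨(hp x o).1.symm, (hp o x).2.symm⟩).symm
      right_inv := fun ⟨⟨a, ha⟩, ⟨b, hb⟩⟩ => Prod.ext
        (Subtype.ext (huniq _ _ _ ⟨ha, (hp b a).2.symm⟩).symm)
        (Subtype.ext (huniq _ _ _ ⟨(hp b a).1.symm, hb⟩).symm) }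
  refine perpendicular_of_equiv_prod h (isTransitivePerm_orbPerm σ₁ o)
    (isTransitivePerm_orbPerm σ₂ o) (fun x => Prod.ext (Subtype.ext ?_) (Subtype.ext ?_))
    (fun x => Prod.ext (Subtype.ext ?_) (Subtype.ext ?_))
  · exact (huniq _ _ _ ⟨Equiv.Perm.sameCycle_apply_right.2 (hp o x).1, hcycle₁ (hp o x).2⟩).symm
  · exact (huniq _ _ _ ⟨Equiv.Perm.sameCycle_apply_left.2 (hp x o).1, (hp x o).2⟩).symm
  · exact (huniq _ _ _ ⟨(hp o x).1, Equiv.Perm.sameCycle_apply_left.2 (hp o x).2⟩).symm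
  · exact (huniq _ _ _ ⟨hcycle₂ (hp x o).1, Equiv.Perm.sameCycle_apply_right.2 (hp x o).2⟩).symm

/-- for commuting permutations `σ₁, σ₂` of a finite nonempty set `X`, the
induced `ℤ²`-action is perpendicular iff (i) every `σ₁`-orbit meets every `σ₂`-orbit in
exactly one point, and (ii) all `σ₁`-orbits have the same cardinality and all `σ₂`-orbits
have the same cardinality. -/
theorem stmt16 {X : Type*} [Fintype X] [Nonempty X] (σ₁ σ₂ : Equiv.Perm X)
    (hcomm : σ₁ * σ₂ = σ₂ * σ₁) :
    Perpendicular σ₁ σ₂ ↔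
      ((∀ x y : X, ∃! z : X, z ∈ Orb σ₁ x ∧ z ∈ Orb σ₂ y) ∧
       (∀ x y : X, (Orb σ₁ x).ncard = (Orb σ₁ y).ncard) ∧
       (∀ x y : X, (Orb σ₂ x).ncard = (Orb σ₂ y).ncard)) := by
  constructor
  · rintro ⟨X₁, X₂, _, _, τ₁, τ₂, h, hτ₁, hτ₂, h₁, h₂⟩
    let h' : X ≃ X₂ × X₁ := h.trans (Equiv.prodComm X₁ X₂)
    have h₂' (x : X) : h' (σ₂ x) = (τ₂ (h' x).1, (h' x).2) := congrArg Prod.swap (h₂ x)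
    refine ⟨fun x y => ⟨h.symm ((h y).1, (h x).2), ?_, ?_⟩, fun x y => ?_, fun x y => ?_⟩
    · simp [mem_orb_iff_snd_eq h hτ₁ h₁, mem_orb_iff_snd_eq h' hτ₂ h₂', h']
    · rintro z ⟨hzx, hzy⟩
      rw [mem_orb_iff_snd_eq h hτ₁ h₁] at hzx
      rw [mem_orb_iff_snd_eq h' hτ₂ h₂'] at hzy
      exact h.eq_symm_apply.2 (Prod.ext hzy hzx)
    · rw [ncard_orb_eq_card h hτ₁ h₁, ncard_orb_eq_card h hτ₁ h₁]
    · rw [ncard_orb_eq_card h' hτ₂ h₂', ncard_orb_eq_card h' hτ₂ h₂']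
  · rintro ⟨hinter, -, -⟩
    exact perpendicular_of_existsUnique_mem_orb hcomm hinter
end

section
/- Let X be a finite nonempty set and σ₁, σ₂ commuting permutations of X such that for all x, y ∈ X the intersection O_{σ₁}^x ∩ O_{σ₂}^y consists of exactly one point. Fix x₀ ∈ X and set X₁ = O_{σ₁}^{x₀}, X₂ = O_{σ₂}^{x₀}. Then the map h : X → X₁ × X₂ defined by h(x) = (y₁, y₂), where y₁ is the unique element of O_{σ₁}^{x₀} ∩ O_{σ₂}^x and y₂ is the unique element of O_{σ₁}^x ∩ O_{σ₂}^{x₀}, is a bijection. -/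
/-- if every `σ₁`-orbit meets every `σ₂`-orbit in exactly one point, then for
any fixed `x₀`, the map `h : X → O_{σ₁}^{x₀} × O_{σ₂}^{x₀}` sending `x` to the pair
(unique point of `O_{σ₁}^{x₀} ∩ O_{σ₂}^x`, unique point of `O_{σ₁}^x ∩ O_{σ₂}^{x₀}`)
is a bijection. -/
theorem stmt18 {X : Type*} [Fintype X] [Nonempty X] (σ₁ σ₂ : Equiv.Perm X)
    (hcomm : σ₁ * σ₂ = σ₂ * σ₁)
    (huniq : ∀ x y : X, ∃! z : X, z ∈ Orb σ₁ x ∧ z ∈ Orb σ₂ y)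
    (x₀ : X) (h : X → ↥(Orb σ₁ x₀) × ↥(Orb σ₂ x₀))
    (h1 : ∀ x : X, ((h x).1 : X) ∈ Orb σ₂ x)
    (h2 : ∀ x : X, ((h x).2 : X) ∈ Orb σ₁ x) :
    Function.Bijective h := by
  have sameCycle_of_mem {σ : Equiv.Perm X} {x y : X} (hy : y ∈ Orb σ x) : σ.SameCycle x y := hy
  constructor
  · intro x x' hxx'
    have hx₁ : σ₁.SameCycle x x' :=
      (sameCycle_of_mem (h2 x)).trans (hxx' ▸ (sameCycle_of_mem (h2 x')).symm)
    have hx₂ : σ₂.SameCycle x x' :=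
      (sameCycle_of_mem (h1 x)).trans (hxx' ▸ (sameCycle_of_mem (h1 x')).symm)
    exact (huniq x x).unique ⟨Equiv.Perm.SameCycle.refl σ₁ x, Equiv.Perm.SameCycle.refl σ₂ x⟩ ⟨hx₁, hx₂⟩
  · rintro ⟨⟨a, ha⟩, ⟨b, hb⟩⟩
    obtain ⟨z, ⟨hz₁, hz₂⟩, -⟩ := huniq b a
    refine ⟨z, Prod.ext (Subtype.ext ?_) (Subtype.ext ?_)⟩
    · exact (huniq x₀ a).unique ⟨(h z).1.2, (sameCycle_of_mem hz₂).trans (h1 z)⟩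
        ⟨ha, Equiv.Perm.SameCycle.refl σ₂ a⟩
    · exact (huniq b x₀).unique ⟨(sameCycle_of_mem hz₁).trans (h2 z), (h z).2.2⟩
        ⟨Equiv.Perm.SameCycle.refl σ₁ b, hb⟩
end
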